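/- (Zinger–Linnik generalization of Cramér's theorem) Let f_1,…,f_m be characteristic functions of Borel probability measures μ_1,…,μ_m on ℝ, let α_1,…,α_m be positive real numbers, let c < 0 and ε > 0 with each f_i nonvanishing on (−ε, ε). If ∏_{i=1}^{m} f_i(t)^{α_i} = exp(c t²) for all |t| < ε, where f_i(t)^{α_i} is defined via the continuous branch of the logarithm with f_i(0) = 1, then each μ_i is a (possibly degenerate) Gaussian distribution. -/

import Mathlib

open MeasureTheory ProbabilityTheory Finset Set

/-- Characteristic function of a Borel probability measure on `ℝ`. -/
noncomputable def charFunM (μ : Measure ℝ) (t : ℝ) : ℂ :=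
  ∫ x, Complex.exp (Complex.I * (t * x)) ∂μ

/-- The Taylor remainder of the cosine, with the sign making it nonnegative:
`cos x = ∑ k < n, (-1) ^ k x ^ (2 k) / (2 k)! + (-1) ^ n cosRem n x`. -/
noncomputable def cosRem : ℕ → ℝ → ℝ
  | 0, x => Real.cos x
  | n + 1, x => x ^ (2 * n) / (2 * n).factorial - cosRem n x

/-- The Taylor remainder of the sine, with the sign making it nonnegative on `[0, ∞)`. -/
noncomputable def sinRem : ℕ → ℝ → ℝ
  | 0, x => Real.sin x
  | n + 1, x => x ^ (2 * n + 1) / (2 * n + 1).factorial - sinRem n x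

theorem cos_eq_sum_add_cosRem (n : ℕ) (x : ℝ) :
    Real.cos x = ∑ k ∈ Finset.range n, (-1) ^ k * (x ^ (2 * k) / (2 * k).factorial)
      + (-1) ^ n * cosRem n x := by
  induction n with
  | zero => simp [cosRem]
  | succ n ih => rw [ih, Finset.sum_range_succ, cosRem]; ring

theorem cosRem_neg (n : ℕ) (x : ℝ) : cosRem n (-x) = cosRem n x := by
  induction n with
  | zero => simp [cosRem]
  | succ n ih => simp [cosRem, ih, pow_mul]

@[fun_prop]
theorem continuous_cosRem (n : ℕ) : Continuous (cosRem n) := by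
  induction n with
  | zero => exact Real.continuous_cos
  | succ n ih =>
    change Continuous fun x => x ^ (2 * n) / (2 * n).factorial - cosRem n x
    fun_prop

theorem hasDerivAt_pow_div_factorial (n : ℕ) (x : ℝ) :
    HasDerivAt (fun x : ℝ => x ^ (n + 1) / (n + 1).factorial) (x ^ n / n.factorial) x := by
  refine ((hasDerivAt_pow (n + 1) x).div_const ((n + 1).factorial : ℝ)).congr_deriv ?_
  have : (n.factorial : ℝ) ≠ 0 := by positivity
  rw [Nat.factorial_succ]
  push_cast
  field_simp

theorem hasDerivAt_sinRem (n : ℕ) (x : ℝ) : HasDerivAt (sinRem n) (cosRem n x) x := by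
  induction n with
  | zero => exact Real.hasDerivAt_sin x
  | succ n ih => exact (hasDerivAt_pow_div_factorial (2 * n) x).sub ih

theorem hasDerivAt_cosRem (n : ℕ) (x : ℝ) : HasDerivAt (cosRem (n + 1)) (sinRem n x) x := by
  induction n with
  | zero =>
    simpa [cosRem, sinRem] using! ((Real.hasDerivAt_cos x).const_sub 1)
  | succ n ih => exact (hasDerivAt_pow_div_factorial (2 * n + 1) x).sub ih

theorem sinRem_zero (n : ℕ) : sinRem n 0 = 0 := by
  induction n with
  | zero => simp [sinRem]
  | succ n ih => simp [sinRem, ih]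

theorem cosRem_zero (n : ℕ) : cosRem (n + 1) 0 = 0 := by
  induction n with
  | zero => simp [cosRem]
  | succ n ih => rw [cosRem, ih]; simp

theorem nonneg_of_hasDerivAt_nonneg {f f' : ℝ → ℝ} (hf : ∀ x, HasDerivAt f (f' x) x)
    (h0 : f 0 = 0) (hf' : ∀ x, 0 ≤ x → 0 ≤ f' x) {x : ℝ} (hx : 0 ≤ x) : 0 ≤ f x := by
  have hm : MonotoneOn f (Set.Ici 0) := by
    apply monotoneOn_of_deriv_nonneg (convex_Ici 0)
      (fun y _ => (hf y).continuousAt.continuousWithinAt)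
      (fun y _ => (hf y).differentiableAt.differentiableWithinAt)
    intro y hy
    rw [interior_Ici] at hy
    rw [(hf y).deriv]
    exact hf' y (le_of_lt hy)
  simpa [h0] using hm (Set.mem_Ici.2 le_rfl) (Set.mem_Ici.2 hx) hx

theorem cosRem_nonneg_of_nonneg (n : ℕ) : ∀ x : ℝ, 0 ≤ x → 0 ≤ cosRem (n + 1) x := by
  induction n with
  | zero =>
    intro x _
    simpa [cosRem] using Real.cos_le_one x
  | succ n ih =>
    intro x hx
    exact nonneg_of_hasDerivAt_nonneg (hasDerivAt_cosRem (n + 1)) (cosRem_zero _)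
      (fun y hy => nonneg_of_hasDerivAt_nonneg (hasDerivAt_sinRem (n + 1)) (sinRem_zero _) ih hy) hx

theorem cosRem_nonneg (n : ℕ) (x : ℝ) : 0 ≤ cosRem (n + 1) x := by
  rcases le_total 0 x with hx | hx
  · exact cosRem_nonneg_of_nonneg n x hx
  · rw [← cosRem_neg]
    exact cosRem_nonneg_of_nonneg n (-x) (by linarith)

theorem cosRem_le (n : ℕ) (x : ℝ) : cosRem (n + 1) x ≤ 2 * (x ^ (2 * n) / (2 * n).factorial) := by
  rcases n with _ | n
  · have := Real.neg_one_le_cos x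
    simp [cosRem]; linarith
  · have h1 := cosRem_nonneg n x
    have h2 : 0 ≤ x ^ (2 * (n + 1)) / (2 * (n + 1)).factorial := by
      have : 0 ≤ x ^ (2 * (n + 1)) := (even_two_mul _).pow_nonneg x
      positivity
    rw [cosRem]; linarith

theorem cosRem_le_succ (n : ℕ) (x : ℝ) :
    cosRem (n + 1) x ≤ x ^ (2 * n + 2) / (2 * n + 2).factorial := by
  have := cosRem_nonneg (n + 1) x
  rw [cosRem] at this
  have h : 2 * (n + 1) = 2 * n + 2 := by ring
  rw [h] at this
  linarith

theorem tendsto_cosRem_div (n : ℕ) (x : ℝ) :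
    Filter.Tendsto (fun t : ℝ => cosRem (n + 1) (t * x) / t ^ (2 * n + 2)) (nhdsWithin 0 (Set.Ioi 0))
      (nhds (x ^ (2 * n + 2) / (2 * n + 2).factorial)) := by
  have hlow : Filter.Tendsto (fun t : ℝ => x ^ (2 * n + 2) / (2 * n + 2).factorial
      - t ^ 2 * (x ^ (2 * n + 4) / (2 * n + 4).factorial)) (nhdsWithin 0 (Set.Ioi 0))
      (nhds (x ^ (2 * n + 2) / (2 * n + 2).factorial)) := by
    apply Filter.Tendsto.mono_left _ nhdsWithin_le_nhds
    have : Continuous (fun t : ℝ => x ^ (2 * n + 2) / (2 * n + 2).factorial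
      - t ^ 2 * (x ^ (2 * n + 4) / (2 * n + 4).factorial)) := by fun_prop
    simpa using this.tendsto 0
  refine tendsto_of_tendsto_of_tendsto_of_le_of_le' hlow tendsto_const_nhds ?_ ?_
  · filter_upwards [self_mem_nhdsWithin] with t ht
    have ht : 0 < t := ht
    rw [le_div_iff₀ (by positivity)]
    have h := cosRem_le_succ (n + 1) (t * x)
    rw [cosRem] at h
    have h1 : 2 * (n + 1) = 2 * n + 2 := by ring
    rw [h1, show 2 * n + 2 + 2 = 2 * n + 4 by ring, mul_pow, mul_pow] at h
    have e : (x ^ (2 * n + 2) / ((2 * n + 2).factorial : ℝ)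
      - t ^ 2 * (x ^ (2 * n + 4) / ((2 * n + 4).factorial : ℝ))) * t ^ (2 * n + 2)
      = t ^ (2 * n + 2) * x ^ (2 * n + 2) / ((2 * n + 2).factorial : ℝ)
       - t ^ (2 * n + 4) * x ^ (2 * n + 4) / ((2 * n + 4).factorial : ℝ) := by ring
    rw [e]; linarith
  · filter_upwards [self_mem_nhdsWithin] with t ht
    have ht : 0 < t := ht
    rw [div_le_iff₀ (by positivity)]
    refine (cosRem_le_succ n (t * x)).trans (le_of_eq ?_)
    rw [mul_pow]; ring

theorem sum_one_div_sq_le_two (n : ℕ) : ∑ k ∈ Finset.range n, 1 / ((k : ℝ) + 1) ^ 2 ≤ 2 := by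
  rcases n with _ | n
  · simp
  suffices h : ∑ k ∈ Finset.range (n + 1), 1 / ((k : ℝ) + 1) ^ 2 ≤ 2 - 1 / (n + 1 : ℝ) by
    have : 0 ≤ 1 / (n + 1 : ℝ) := by positivity
    linarith
  induction n with
  | zero => norm_num
  | succ n ih =>
    rw [Finset.sum_range_succ]
    push_cast
    have h : 1 / ((n : ℝ) + 1 + 1) ^ 2 ≤ 1 / (n + 1 : ℝ) - 1 / (n + 1 + 1 : ℝ) := by
      rw [div_sub_div _ _ (by positivity) (by positivity),
        div_le_div_iff₀ (by positivity) (by positivity)]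
      have : (0 : ℝ) ≤ n := by positivity
      nlinarith
    linarith

theorem sum_convolution_le (N : ℕ) :
    ∑ k ∈ Finset.range N, 1 / (((k : ℝ) + 1) * ((N - k : ℕ) : ℝ) ^ 2) ≤ 4 / ((N : ℝ) + 1) := by
  have hsq := sum_one_div_sq_le_two N
  have hsq' : ∑ k ∈ Finset.range N, 1 / ((N - k : ℕ) : ℝ) ^ 2 ≤ 2 := by
    rw [← Finset.sum_range_reflect]
    refine (Finset.sum_le_sum fun k hk => ?_).trans hsq
    have hk := Finset.mem_range.1 hk
    rw [show N - (N - 1 - k) = k + 1 by omega]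
    push_cast
    exact le_rfl
  rw [le_div_iff₀ (by positivity), Finset.sum_mul]
  calc ∑ k ∈ Finset.range N, 1 / (((k : ℝ) + 1) * ((N - k : ℕ) : ℝ) ^ 2) * (N + 1)
      ≤ ∑ k ∈ Finset.range N, (1 / ((k : ℝ) + 1) ^ 2 * (1 / 2)
          + 1 / ((N - k : ℕ) : ℝ) ^ 2 * (3 / 2)) := by
        refine Finset.sum_le_sum fun k hk => ?_
        have hk := Finset.mem_range.1 hk
        have hpos : (0 : ℝ) < ((N - k : ℕ) : ℝ) := by exact_mod_cast (by omega : 0 < N - k)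
        have hN : (N : ℝ) = (N - k : ℕ) + k := by
          rw [← Nat.cast_add, Nat.sub_add_cancel hk.le]
        set b : ℝ := ((N - k : ℕ) : ℝ)
        set a : ℝ := (k : ℝ) + 1 with ha
        have hapos : 0 < a := by positivity
        have : (N : ℝ) + 1 = a + b := by rw [hN, ha]; ring
        rw [this]
        have e : 1 / a ^ 2 * (1 / 2) + 1 / b ^ 2 * (3 / 2) - 1 / (a * b ^ 2) * (a + b)
          = (1 / a - 1 / b) ^ 2 / 2 := by field_simp; ring
        nlinarith [sq_nonneg (1 / a - 1 / b)]
    _ ≤ 4 := by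
        rw [Finset.sum_add_distrib, ← Finset.sum_mul, ← Finset.sum_mul]
        linarith

/-- Geometric growth of even moments `a` from the recursive inequalities they satisfy together with
the coefficients `lam` of the logarithmic derivative. -/
theorem exists_geometric_bound {ι : Type*} [Fintype ι] (α : ι → ℝ) (hα : ∀ i, 0 < α i)
    (a lam : ι → ℕ → ℝ) (ha : ∀ i n, 0 ≤ a i n)
    (h1 : ∀ N, 1 ≤ N → ∀ i, (N + 1) * (α i * a i (N + 1)) ≤
      ∑ j, α j * ∑ k ∈ Finset.range N, |lam j k| * a j (N - k))
    (h2 : ∀ N i, |lam i N| ≤ (N + 1) * a i (N + 1)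
      + ∑ k ∈ Finset.range N, |lam i k| * a i (N - k)) :
    ∃ ρ : ℝ, 0 < ρ ∧ ∀ i n, a i (n + 1) ≤ ρ ^ (n + 1) := by
  set S : ℝ := ∑ i, (∑ j, α j) / α i with hS
  have hαs : 0 ≤ ∑ j, α j := Finset.sum_nonneg fun j _ => (hα j).le
  have hSi : ∀ i, (∑ j, α j) ≤ S * α i := fun i => by
    rw [← div_le_iff₀ (hα i)]
    exact Finset.single_le_sum (f := fun i => (∑ j, α j) / α i)
      (fun j _ => div_nonneg hαs (hα j).le) (Finset.mem_univ i)
  have hS0 : 0 ≤ S := Finset.sum_nonneg fun j _ => div_nonneg hαs (hα j).le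
  set B : ℝ := 1 / (4 * (1 + S)) with hB
  have hBpos : 0 < B := by positivity
  have hB4 : 4 * B * (1 + S) = 1 := by rw [hB]; field_simp
  have hB1 : 4 * B ≤ 1 := by nlinarith
  have hBS : 4 * B * S ≤ 1 := by nlinarith
  set A : ℝ := B / 2 with hA
  have hApos : 0 < A := by positivity
  set ρ : ℝ := ∑ i, a i 1 / A + 1 with hρ
  have hρpos : 0 < ρ := by
    have : 0 ≤ ∑ i, a i 1 / A := Finset.sum_nonneg fun j _ => div_nonneg (ha j 1) hApos.le
    linarith
  have hbase : ∀ i, a i 1 ≤ A * ρ := fun i => by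
    have : a i 1 / A ≤ ∑ i, a i 1 / A := Finset.single_le_sum (f := fun i => a i 1 / A)
      (fun j _ => div_nonneg (ha j 1) hApos.le) (Finset.mem_univ i)
    have : a i 1 / A ≤ ρ := by linarith
    rw [div_le_iff₀ hApos] at this
    linarith
  have key : ∀ N i, a i (N + 1) ≤ A * ρ ^ (N + 1) / (N + 1 : ℝ) ^ 2 ∧
      |lam i N| ≤ B * ρ ^ (N + 1) / (N + 1 : ℝ) := by
    intro N
    induction N using Nat.strong_induction_on with
    | _ N ih =>
    have hconv : ∀ i, ∑ k ∈ Finset.range N, |lam i k| * a i (N - k)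
        ≤ 4 * B * (A * ρ ^ (N + 1)) / (N + 1 : ℝ) := by
      intro i
      calc ∑ k ∈ Finset.range N, |lam i k| * a i (N - k)
          ≤ ∑ k ∈ Finset.range N, (B * A * ρ ^ (N + 1)) *
            (1 / (((k : ℝ) + 1) * ((N - k : ℕ) : ℝ) ^ 2)) := by
            refine Finset.sum_le_sum fun k hk => ?_
            have hk := Finset.mem_range.1 hk
            have hl := (ih k hk i).2
            have hr := (ih (N - k - 1) (by omega) i).1
            have hpos : (0 : ℝ) < ((N - k : ℕ) : ℝ) := by exact_mod_cast (by omega : 0 < N - k)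
            have hc : ((N - k - 1 : ℕ) : ℝ) + 1 = ((N - k : ℕ) : ℝ) := by
              exact_mod_cast (by omega : N - k - 1 + 1 = N - k)
            rw [hc, show N - k - 1 + 1 = N - k by omega] at hr
            refine (mul_le_mul hl hr (ha _ _) (by positivity)).trans (le_of_eq ?_)
            rw [show ρ ^ (N + 1) = ρ ^ (k + 1) * ρ ^ (N - k) by rw [← pow_add]; congr 1; omega]
            field_simp
        _ ≤ (B * A * ρ ^ (N + 1)) * (4 / (N + 1 : ℝ)) := by
            rw [← Finset.mul_sum]
            exact mul_le_mul_of_nonneg_left (sum_convolution_le N) (by positivity)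
        _ = _ := by ring
    have hfst : ∀ i, a i (N + 1) ≤ A * ρ ^ (N + 1) / (N + 1 : ℝ) ^ 2 := by
      intro i
      rcases Nat.eq_zero_or_pos N with h0 | hN
      · subst h0
        simpa using hbase i
      · have h := h1 N hN i
        have h' : ∑ j, α j * ∑ k ∈ Finset.range N, |lam j k| * a j (N - k)
            ≤ α i * (A * ρ ^ (N + 1)) / (N + 1 : ℝ) := by
          calc _ ≤ ∑ j, α j * (4 * B * (A * ρ ^ (N + 1)) / (N + 1 : ℝ)) :=
                Finset.sum_le_sum fun j _ => mul_le_mul_of_nonneg_left (hconv j) (hα j).le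
            _ = (∑ j, α j) * (4 * B) * (A * ρ ^ (N + 1) / (N + 1 : ℝ)) := by
                rw [← Finset.sum_mul]; ring
            _ ≤ α i * (A * ρ ^ (N + 1) / (N + 1 : ℝ)) := by
                refine mul_le_mul_of_nonneg_right ?_ (by positivity)
                have := hSi i
                have := hα i
                nlinarith
            _ = _ := by ring
        have h'' := h.trans h'
        have hαi := hα i
        rw [le_div_iff₀ (by positivity)] at h'' ⊢
        have : α i * (a i (N + 1) * (N + 1 : ℝ) ^ 2) ≤ α i * (A * ρ ^ (N + 1)) := by
          calc _ = _ := by ring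
            _ ≤ _ := h''
        exact le_of_mul_le_mul_left this hαi
    intro i
    refine ⟨hfst i, (h2 N i).trans ?_⟩
    have e1 := hfst i
    have e2 := hconv i
    have e3 : ((N : ℝ) + 1) * a i (N + 1) ≤ A * ρ ^ (N + 1) / (N + 1 : ℝ) := by
      rw [le_div_iff₀ (by positivity)] at e1 ⊢
      linarith
    calc _ ≤ A * ρ ^ (N + 1) / (N + 1 : ℝ) + 4 * B * (A * ρ ^ (N + 1)) / (N + 1 : ℝ) :=
          add_le_add e3 e2
      _ = (A + 4 * B * A) * (ρ ^ (N + 1) / (N + 1 : ℝ)) := by ring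
      _ ≤ B * (ρ ^ (N + 1) / (N + 1 : ℝ)) := by
          refine mul_le_mul_of_nonneg_right ?_ (by positivity)
          rw [hA]; nlinarith
      _ = _ := by ring
  refine ⟨ρ, hρpos, fun i n => ((key n i).1).trans ?_⟩
  have hA1 : A ≤ 1 := by rw [hA]; linarith
  rw [div_le_iff₀ (by positivity)]
  have h1 : (1 : ℝ) ≤ (n + 1 : ℝ) ^ 2 := by
    have : (0 : ℝ) ≤ n := by positivity
    nlinarith
  have hp : 0 < ρ ^ (n + 1) := by positivity
  nlinarith

/-- The polynomial `∑ k ≤ N, p k X ^ k`. -/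
noncomputable def truncPoly (p : ℕ → ℝ) (N : ℕ) : Polynomial ℝ :=
  ∑ k ∈ Finset.range (N + 1), Polynomial.C (p k) * Polynomial.X ^ k

/-- The Taylor polynomial of degree `N + 1` of the logarithm of `truncPoly p N`, where `lam` are
the coefficients of the logarithmic derivative of the formal power series `p`. -/
noncomputable def logPoly (p lam : ℕ → ℝ) (N : ℕ) : Polynomial ℝ :=
  ∑ k ∈ Finset.range (N + 1), Polynomial.C (lam k / (k + 1)) * Polynomial.X ^ (k + 1)
    - Polynomial.C (p (N + 1)) * Polynomial.X ^ (N + 1)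

theorem coeff_truncPoly (p : ℕ → ℝ) (N m : ℕ) :
    (truncPoly p N).coeff m = if m ≤ N then p m else 0 := by
  simp [truncPoly, Polynomial.coeff_X_pow]

theorem coeff_succ_logPoly (p lam : ℕ → ℝ) (N m : ℕ) :
    (logPoly p lam N).coeff (m + 1) =
      (if m ≤ N then lam m / (m + 1) else 0) - if m = N then p (N + 1) else 0 := by
  simp [logPoly, Polynomial.coeff_X_pow]

theorem coeff_zero_logPoly (p lam : ℕ → ℝ) (N : ℕ) : (logPoly p lam N).coeff 0 = 0 := by
  simp [logPoly, Polynomial.coeff_X_pow]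

theorem X_pow_dvd_derivative_sub (p lam : ℕ → ℝ) (hp : p 0 = 1)
    (hlam : ∀ n, ∑ x ∈ Finset.HasAntidiagonal.antidiagonal n, lam x.1 * p x.2 =
      (n + 1) * p (n + 1)) (N : ℕ) :
    Polynomial.X ^ (N + 1) ∣ Polynomial.derivative (truncPoly p N)
      - Polynomial.derivative (logPoly p lam N) * truncPoly p N := by
  rw [Polynomial.X_pow_dvd_iff]
  intro m hm
  have hm : m ≤ N := Nat.lt_succ_iff.1 hm
  rw [Polynomial.coeff_sub, Polynomial.coeff_derivative, Polynomial.coeff_mul, coeff_truncPoly]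
  have : ∀ x ∈ Finset.HasAntidiagonal.antidiagonal m, (Polynomial.derivative (logPoly p lam N)).coeff x.1
      * (truncPoly p N).coeff x.2
      = lam x.1 * p x.2 - if x = (N, 0) then (N + 1) * p (N + 1) else 0 := by
    intro x hx
    have hx := Finset.HasAntidiagonal.mem_antidiagonal.1 hx
    rw [Polynomial.coeff_derivative, coeff_succ_logPoly, coeff_truncPoly,
      if_pos (show x.1 ≤ N by omega), if_pos (show x.2 ≤ N by omega)]
    have h1 : (x.1 : ℝ) + 1 ≠ 0 := by positivity
    by_cases h : x.1 = N
    · have h2 : x.2 = 0 := by omega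
      have h3 : x = (N, 0) := Prod.ext h h2
      rw [h3]
      simp only [if_true, hp]
      rw [h] at h1
      field_simp
    · have h3 : x ≠ (N, 0) := fun e => h (by rw [e])
      simp only [h, h3, if_false]
      field_simp
      ring
  rw [Finset.sum_congr rfl this, Finset.sum_sub_distrib, hlam]
  rcases hm.lt_or_eq with h | h
  · rw [if_pos (by omega), Finset.sum_ite_eq', if_neg]
    · ring
    · simp; omega
  · subst h
    rw [if_neg (by omega), Finset.sum_ite_eq', if_pos (by simp)]
    ring

theorem isLittleO_of_hasDerivAt_isBigO {G G' : ℝ → ℝ} {n : ℕ} (h0 : G 0 = 0)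
    (hG : ∀ᶠ s in nhds (0 : ℝ), HasDerivAt G (G' s) s)
    (hG' : G' =O[nhds 0] fun s : ℝ => s ^ n) : G =o[nhds 0] fun s : ℝ => s ^ n := by
  obtain ⟨C, hC⟩ := hG'.bound
  obtain ⟨δ, hδ, h⟩ := Metric.eventually_nhds_iff.1 (hG.and hC)
  have hbig : G =O[nhds 0] fun s : ℝ => s ^ n * s := by
    refine Asymptotics.IsBigO.of_bound C ?_
    filter_upwards [Metric.ball_mem_nhds (0 : ℝ) hδ] with s hs
    have hs : |s| < δ := by simpa using hs
    have hmem : ∀ x ∈ Set.Icc (-|s|) |s|, dist x 0 < δ ∧ |x| ≤ |s| := fun x hx => by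
      have := abs_le.2 hx
      exact ⟨by simpa using lt_of_le_of_lt this hs, this⟩
    have hb : ∀ x ∈ Set.Icc (-|s|) |s|, ‖G' x‖ ≤ |C| * |s| ^ n := fun x hx => by
      obtain ⟨h1, h2⟩ := hmem x hx
      refine ((h h1).2).trans ?_
      rw [norm_pow, Real.norm_eq_abs]
      gcongr
      exact le_abs_self C
    have := Convex.norm_image_sub_le_of_norm_hasDerivWithin_le (f := G) (f' := G')
      (fun x hx => ((h (hmem x hx).1).1).hasDerivWithinAt) hb (convex_Icc _ _)
      (x := 0) (y := s) ⟨by simp, by simp⟩ (abs_le.1 le_rfl)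
    have hCn : 0 ≤ C ∨ s = 0 := by
      by_cases hs0 : s = 0
      · exact Or.inr hs0
      · left
        have h3 := (h (hmem s (abs_le.1 le_rfl)).1).2
        have h4 : 0 ≤ C * ‖s ^ n‖ := (norm_nonneg _).trans h3
        exact nonneg_of_mul_nonneg_left h4 (norm_pos_iff.2 (pow_ne_zero _ hs0))
    rcases hCn with hCn | rfl
    · rw [h0, sub_zero, sub_zero, abs_of_nonneg hCn] at this
      rw [norm_mul, norm_pow]
      calc _ ≤ _ := this
        _ = _ := by simp only [Real.norm_eq_abs]; ring
    · simp [h0]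
  refine hbig.trans_isLittleO ?_
  have : (fun s : ℝ => s) =o[nhds 0] fun _ : ℝ => (1 : ℝ) :=
    (Asymptotics.isLittleO_one_iff ℝ).2 Filter.tendsto_id
  simpa using (Asymptotics.isBigO_refl (fun s : ℝ => s ^ n) (nhds 0)).mul_isLittleO this

theorem isBigO_pow_of_X_pow_dvd {W : Polynomial ℝ} {n : ℕ} (h : Polynomial.X ^ n ∣ W) :
    (fun s => W.eval s) =O[nhds 0] fun s : ℝ => s ^ n := by
  obtain ⟨V, rfl⟩ := h
  have : (fun s => V.eval s) =O[nhds 0] fun _ : ℝ => (1 : ℝ) :=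
    (V.continuous.tendsto 0).isBigO_one ℝ
  simpa using (Asymptotics.isBigO_refl (fun s : ℝ => s ^ n) (nhds 0)).mul this

theorem eval_zero_truncPoly {p : ℕ → ℝ} (hp : p 0 = 1) (N : ℕ) : (truncPoly p N).eval 0 = 1 := by
  rw [← Polynomial.coeff_zero_eq_eval_zero, coeff_truncPoly, if_pos (Nat.zero_le _), hp]

theorem isLittleO_log_truncPoly (p lam : ℕ → ℝ) (hp : p 0 = 1)
    (hlam : ∀ n, ∑ x ∈ Finset.HasAntidiagonal.antidiagonal n, lam x.1 * p x.2 =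
      (n + 1) * p (n + 1)) (N : ℕ) :
    (fun s => Real.log ((truncPoly p N).eval s) - (logPoly p lam N).eval s)
      =o[nhds 0] fun s : ℝ => s ^ (N + 1) := by
  set P := truncPoly p N with hP
  have hP0 : P.eval 0 = 1 := eval_zero_truncPoly hp N
  have hcont : Filter.Tendsto (fun s => P.eval s) (nhds 0) (nhds 1) := by
    simpa [hP0] using P.continuous.tendsto 0
  refine isLittleO_of_hasDerivAt_isBigO
    (G' := fun s => (Polynomial.derivative P
      - Polynomial.derivative (logPoly p lam N) * P).eval s * (P.eval s)⁻¹) ?_ ?_ ?_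
  · rw [hP0, ← Polynomial.coeff_zero_eq_eval_zero, coeff_zero_logPoly]; simp
  · filter_upwards [hcont.eventually_ne one_ne_zero] with s hs
    refine (((P.hasDerivAt s).log hs).sub ((logPoly p lam N).hasDerivAt s)).congr_deriv ?_
    simp only [Polynomial.eval_sub, Polynomial.eval_mul]
    field_simp
  · have h1 := isBigO_pow_of_X_pow_dvd (X_pow_dvd_derivative_sub p lam hp hlam N)
    have h2 : (fun s => (P.eval s)⁻¹) =O[nhds 0] fun _ : ℝ => (1 : ℝ) :=
      (hcont.inv₀ one_ne_zero).isBigO_one ℝ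
    simpa using h1.mul h2

theorem X_pow_dvd_of_isLittleO (q : Polynomial ℝ) (N : ℕ)
    (h : (fun s => q.eval s) =o[nhdsWithin 0 (Set.Ioi 0)] fun s : ℝ => s ^ N) :
    Polynomial.X ^ (N + 1) ∣ q := by
  by_cases hq : q = 0
  · simp [hq]
  obtain ⟨r, hr⟩ : Polynomial.X ^ q.natTrailingDegree ∣ q := by
    rw [Polynomial.X_pow_dvd_iff]
    exact fun m hm => Polynomial.coeff_eq_zero_of_lt_natTrailingDegree hm
  set k := q.natTrailingDegree with hk
  have hr0 : r.eval 0 ≠ 0 := by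
    rw [← Polynomial.coeff_zero_eq_eval_zero]
    have : q.coeff k = r.coeff 0 := by
      conv_lhs => rw [hr]
      simpa using Polynomial.coeff_X_pow_mul r k 0
    rw [← this]
    exact Polynomial.trailingCoeff_nonzero_iff_nonzero.2 hq
  by_cases hkN : N < k
  · exact (pow_dvd_pow _ hkN).trans ⟨r, hr⟩
  exfalso
  have hkN : k ≤ N := not_lt.1 hkN
  have h1 : (fun s : ℝ => s ^ N) =O[nhdsWithin 0 (Set.Ioi 0)] fun s : ℝ => s ^ k := by
    refine Asymptotics.IsBigO.of_bound 1 ?_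
    filter_upwards [Ioo_mem_nhdsGT (show (0 : ℝ) < 1 by norm_num)] with s hs
    rw [one_mul, norm_pow, norm_pow]
    refine pow_le_pow_of_le_one (norm_nonneg _) ?_ hkN
    rw [Real.norm_of_nonneg hs.1.le]; exact hs.2.le
  have h2 := (h.trans_isBigO h1).tendsto_div_nhds_zero
  have h3 : Filter.Tendsto (fun s => q.eval s / s ^ k) (nhdsWithin 0 (Set.Ioi 0))
      (nhds (r.eval 0)) := by
    refine ((r.continuous.tendsto 0).mono_left nhdsWithin_le_nhds).congr' ?_
    filter_upwards [self_mem_nhdsWithin] with s hs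
    have hs : 0 < s := hs
    conv_rhs => rw [hr]
    simp only [Polynomial.eval_mul, Polynomial.eval_pow, Polynomial.eval_X]
    field_simp
  exact hr0 (tendsto_nhds_unique h3 h2)

theorem remainder_le_of_sum_log_eq {ι : Type*} [Fintype ι] (α : ι → ℝ) (hα : ∀ i, 0 < α i) (c : ℝ)
    (p lam : ι → ℕ → ℝ) (hp : ∀ i, p i 0 = 1)
    (hlam : ∀ i n, ∑ x ∈ Finset.HasAntidiagonal.antidiagonal n, lam i x.1 * p i x.2
      = (n + 1) * p i (n + 1)) (N : ℕ) (R : ι → ℝ → ℝ) (hR0 : ∀ i t, 0 ≤ R i t)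
    (hRo : ∀ i, R i =o[nhdsWithin 0 (Set.Ioi 0)] fun t : ℝ => t ^ (2 * N))
    (heq : ∀ᶠ t in nhdsWithin (0 : ℝ) (Set.Ioi 0),
      ∑ i, α i * Real.log ((truncPoly (p i) N).eval (t ^ 2) + (-1) ^ (N + 1) * R i t)
        = -c * t ^ 2) (i : ι) :
    ∃ u : ℝ → ℝ, Filter.Tendsto u (nhdsWithin 0 (Set.Ioi 0))
      (nhds ((-1) ^ (N + 1) * ((if N = 0 then -c else 0)
        - ∑ j, α j * (lam j N / (N + 1) - p j (N + 1))) / α i)) ∧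
      ∀ᶠ t in nhdsWithin (0 : ℝ) (Set.Ioi 0), R i t ≤ u t * t ^ (2 * N + 2) := by
  set l : Filter ℝ := nhdsWithin 0 (Set.Ioi 0) with hl
  set σ : ℝ := (-1) ^ (N + 1) with hσ
  have hσσ : σ * σ = 1 := by rw [hσ, ← mul_pow]; simp
  have hσ1 : σ = 1 ∨ σ = -1 := by
    rcases mul_self_eq_one_iff.1 hσσ with h | h
    · exact Or.inl h
    · exact Or.inr h
  have hpos : ∀ᶠ t in l, 0 < t := self_mem_nhdsWithin
  have hsq : Filter.Tendsto (fun t : ℝ => t ^ 2) l (nhds 0) := by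
    have : Filter.Tendsto (fun t : ℝ => t ^ 2) (nhds 0) (nhds 0) := by
      simpa using (continuous_pow (M := ℝ) 2).tendsto 0
    exact this.mono_left nhdsWithin_le_nhds
  have hP : ∀ j, Filter.Tendsto (fun t : ℝ => (truncPoly (p j) N).eval (t ^ 2)) l (nhds 1) := by
    intro j
    have := (truncPoly (p j) N).continuous.tendsto 0
    rw [eval_zero_truncPoly (hp j)] at this
    exact this.comp hsq
  have hR : ∀ j, Filter.Tendsto (R j) l (nhds 0) := by
    intro j
    have hb : (fun t : ℝ => t ^ (2 * N)) =O[l] fun _ : ℝ => (1 : ℝ) :=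
      (((continuous_pow (M := ℝ) (2 * N)).tendsto 0).mono_left nhdsWithin_le_nhds).isBigO_one ℝ
    exact (Asymptotics.isLittleO_one_iff ℝ).1 ((hRo j).trans_isBigO hb)
  set x : ι → ℝ → ℝ := fun j t => σ * R j t * ((truncPoly (p j) N).eval (t ^ 2))⁻¹ with hx
  have hx0 : ∀ j, Filter.Tendsto (fun t => 1 + x j t) l (nhds 1) := by
    intro j
    have := (((hR j).const_mul σ).mul ((hP j).inv₀ one_ne_zero)).const_add 1
    simpa [hx] using this
  have hxo : ∀ j, x j =o[l] fun t : ℝ => t ^ (2 * N) := by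
    intro j
    have h1 : (fun t => ((truncPoly (p j) N).eval (t ^ 2))⁻¹) =O[l] fun _ : ℝ => (1 : ℝ) :=
      ((hP j).inv₀ one_ne_zero).isBigO_one ℝ
    simpa using ((hRo j).const_mul_left σ).mul_isBigO h1
  set D : ι → ℝ → ℝ := fun j t => Real.log (1 + x j t) with hD
  have hDo : ∀ j, D j =o[l] fun t : ℝ => t ^ (2 * N) := by
    intro j
    have h1 := ((Real.hasDerivAt_log one_ne_zero).isBigO_sub).comp_tendsto (hx0 j)
    have h2 : D j =O[l] x j := by
      simpa [Function.comp_def, hD] using h1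
    exact h2.trans_isLittleO (hxo j)
  have hlog : ∀ᶠ t in l, ∀ j, Real.log ((truncPoly (p j) N).eval (t ^ 2) + σ * R j t)
      = Real.log ((truncPoly (p j) N).eval (t ^ 2)) + D j t := by
    rw [Filter.eventually_all]
    intro j
    filter_upwards [(hP j).eventually_ne one_ne_zero, (hx0 j).eventually_ne one_ne_zero]
      with t h1 h2
    rw [hD, ← Real.log_mul h1 h2]
    congr 1
    simp only [hx]
    field_simp
  set q : Polynomial ℝ := Polynomial.C (-c) * Polynomial.X
    - ∑ j, Polynomial.C (α j) * logPoly (p j) (lam j) N with hq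
  have hqcoeff : q.coeff (N + 1) = (if N = 0 then -c else 0)
        - ∑ j, α j * (lam j N / (N + 1) - p j (N + 1)) := by
    rw [hq]
    by_cases h : N = 0
    · subst h; simp [coeff_succ_logPoly]
    · simp [coeff_succ_logPoly, h, Polynomial.coeff_C]
  have hqD : (fun t => ∑ j, α j * D j t - q.eval (t ^ 2)) =o[l] fun t : ℝ => t ^ (2 * N + 2) := by
    have h1 : (fun t => ∑ j, (-α j) * (Real.log ((truncPoly (p j) N).eval (t ^ 2))
        - (logPoly (p j) (lam j) N).eval (t ^ 2))) =o[l] fun t : ℝ => t ^ (2 * N + 2) := by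
      refine Asymptotics.IsLittleO.fun_sum fun j _ => ?_
      have := (isLittleO_log_truncPoly (p j) (lam j) (hp j) (hlam j) N).comp_tendsto hsq
      refine (this.congr_right fun t => ?_).const_mul_left _
      simp only [Function.comp]
      rw [← pow_mul]; congr 1
    refine h1.congr' ?_ (Filter.EventuallyEq.refl _ _)
    filter_upwards [hlog, heq] with t h2 h3
    simp_rw [h2] at h3
    rw [hq]
    simp only [Polynomial.eval_sub, Polynomial.eval_mul, Polynomial.eval_C, Polynomial.eval_X,
      Polynomial.eval_finsetSum]
    rw [← h3]
    simp only [mul_add, mul_sub, neg_mul, Finset.sum_add_distrib, Finset.sum_sub_distrib,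
      Finset.sum_neg_distrib]
    ring
  have hqo : (fun t => q.eval (t ^ 2)) =o[l] fun t : ℝ => t ^ (2 * N) := by
    have h1 : (fun t => ∑ j, α j * D j t) =o[l] fun t : ℝ => t ^ (2 * N) :=
      Asymptotics.IsLittleO.fun_sum fun j _ => (hDo j).const_mul_left _
    have h2 : (fun t : ℝ => t ^ (2 * N + 2)) =O[l] fun t : ℝ => t ^ (2 * N) := by
      simpa [pow_add] using (Asymptotics.isBigO_refl (fun t : ℝ => t ^ (2 * N)) l).mul
        (hsq.isBigO_one ℝ)
    simpa using h1.sub (hqD.trans_isBigO h2)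
  have hsqrt : Filter.Tendsto Real.sqrt l l := by
    refine tendsto_nhdsWithin_iff.2 ⟨?_, ?_⟩
    · have := Real.continuous_sqrt.tendsto 0
      rw [Real.sqrt_zero] at this
      exact this.mono_left nhdsWithin_le_nhds
    · filter_upwards [hpos] with t ht
      exact Real.sqrt_pos.2 ht
  have hqs : (fun s => q.eval s) =o[l] fun s : ℝ => s ^ N := by
    refine (hqo.comp_tendsto hsqrt).congr' ?_ ?_
    · filter_upwards [hpos] with s hs
      simp [Function.comp, Real.sq_sqrt hs.le]
    · filter_upwards [hpos] with s hs
      simp [Function.comp, pow_mul, Real.sq_sqrt hs.le]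
  obtain ⟨r, hr⟩ := X_pow_dvd_of_isLittleO q N hqs
  have hr0 : r.eval 0 = q.coeff (N + 1) := by
    rw [← Polynomial.coeff_zero_eq_eval_zero]
    conv_rhs => rw [hr]
    simpa using (Polynomial.coeff_X_pow_mul r (N + 1) 0).symm
  have hqt : Filter.Tendsto (fun t => q.eval (t ^ 2) / t ^ (2 * N + 2)) l
      (nhds (q.coeff (N + 1))) := by
    rw [← hr0]
    refine ((r.continuous.tendsto 0).comp hsq).congr' ?_
    filter_upwards [hpos] with t ht
    conv_rhs => rw [hr]
    simp only [Polynomial.eval_mul, Polynomial.eval_pow, Polynomial.eval_X, Function.comp]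
    rw [← pow_mul, show 2 * (N + 1) = 2 * N + 2 by ring]
    field_simp
  set w : ℝ → ℝ := fun t => σ * ((∑ j, α j * D j t) / t ^ (2 * N + 2)) with hw
  have hwt : Filter.Tendsto w l (nhds (σ * q.coeff (N + 1))) := by
    have := (hqD.tendsto_div_nhds_zero.add hqt).const_mul σ
    rw [zero_add] at this
    refine this.congr fun t => ?_
    simp only [hw]; ring
  have hpw : Filter.Tendsto (fun t : ℝ => t ^ (2 * N + 2)) l (nhds 0) := by
    have : Filter.Tendsto (fun t : ℝ => t ^ (2 * N + 2)) (nhds 0) (nhds 0) := by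
      simpa using (continuous_pow (M := ℝ) (2 * N + 2)).tendsto 0
    exact this.mono_left nhdsWithin_le_nhds
  have hv : Filter.Tendsto (fun t => w t / α i * t ^ (2 * N + 2)) l (nhds 0) := by
    simpa using (hwt.div_const (α i)).mul hpw
  refine ⟨fun t => (truncPoly (p i) N).eval (t ^ 2) * (w t / α i *
    (1 + w t / α i * t ^ (2 * N + 2))), ?_, ?_⟩
  · rw [← hqcoeff]
    have := (hP i).mul ((hwt.div_const (α i)).mul (hv.const_add 1))
    simpa using this
  have hsign : ∀ᶠ t in l, ∀ j, 0 < (truncPoly (p j) N).eval (t ^ 2) ∧ 0 < 1 + x j t := by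
    rw [Filter.eventually_all]
    exact fun j => ((hP j).eventually (lt_mem_nhds one_pos)).and
      ((hx0 j).eventually (lt_mem_nhds one_pos))
  filter_upwards [hpos, hsign, hv.eventually (gt_mem_nhds one_pos)] with t ht hs hv1
  have hdn : ∀ j, 0 ≤ σ * D j t := by
    intro j
    obtain ⟨h1, h2⟩ := hs j
    have h3 : 0 ≤ R j t * ((truncPoly (p j) N).eval (t ^ 2))⁻¹ :=
      mul_nonneg (hR0 j t) (inv_nonneg.2 h1.le)
    rcases hσ1 with h | h
    · rw [h, one_mul]
      apply Real.log_nonneg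
      simp only [hx, h]; linarith
    · rw [h, neg_one_mul]
      have : D j t ≤ 0 := by
        apply Real.log_nonpos h2.le
        simp only [hx, h]; linarith
      linarith
  obtain ⟨hPi, hxi⟩ := hs i
  have htp : 0 < t ^ (2 * N + 2) := by positivity
  have hd : σ * D i t ≤ w t / α i * t ^ (2 * N + 2) := by
    have h1 : α i * (σ * D i t) ≤ ∑ j, α j * (σ * D j t) :=
      Finset.single_le_sum (f := fun j => α j * (σ * D j t))
        (fun j _ => mul_nonneg (hα j).le (hdn j)) (Finset.mem_univ i)
    have h2 : ∑ j, α j * (σ * D j t) = w t * t ^ (2 * N + 2) := by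
      simp only [hw]
      rw [mul_assoc, div_mul_cancel₀ _ htp.ne', Finset.mul_sum]
      exact Finset.sum_congr rfl fun j _ => by ring
    rw [h2] at h1
    rw [div_mul_eq_mul_div, le_div_iff₀ (hα i)]
    linarith
  set v := w t / α i * t ^ (2 * N + 2) with hvdef
  have hv0 : 0 ≤ v := (hdn i).trans hd
  have hexp : Real.exp (σ * D i t) - 1 ≤ v * (1 + v) := by
    have h1 : Real.exp (σ * D i t) ≤ Real.exp v := Real.exp_le_exp.2 hd
    have h2 := (abs_le.1 (Real.abs_exp_sub_one_sub_id_le (x := v)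
      (by rw [abs_of_nonneg hv0]; exact hv1.le))).2
    nlinarith
  have hRP : R i t * ((truncPoly (p i) N).eval (t ^ 2))⁻¹ ≤ Real.exp (σ * D i t) - 1 := by
    rcases hσ1 with h | h
    · rw [h, one_mul, hD, Real.exp_log hxi]
      simp only [hx, h]; linarith
    · have h1 := Real.add_one_le_exp (σ * D i t)
      have h2 := Real.add_one_le_exp (D i t)
      rw [hD, Real.exp_log hxi] at h2
      simp only [hx, h] at h1 h2 ⊢
      simp only [hD, hx, h] at h1 ⊢
      linarith
  have h3 := hRP.trans hexp
  rw [← div_eq_mul_inv, div_le_iff₀ hPi] at h3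
  refine h3.trans (le_of_eq ?_)
  rw [hvdef]; ring

theorem exists_logDeriv_coeff (p : ℕ → ℝ) (hp : p 0 = 1) :
    ∃ lam : ℕ → ℝ, ∀ n, ∑ x ∈ Finset.HasAntidiagonal.antidiagonal n, lam x.1 * p x.2
      = (n + 1) * p (n + 1) := by
  set Q : PowerSeries ℝ := PowerSeries.mk fun n => ((n : ℝ) + 1) * p (n + 1)
  refine ⟨fun n => PowerSeries.coeff n (Q * (PowerSeries.mk p)⁻¹), fun n => ?_⟩
  have h : Q * (PowerSeries.mk p)⁻¹ * PowerSeries.mk p = Q := by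
    rw [mul_assoc, PowerSeries.inv_mul_cancel, mul_one]
    rw [← PowerSeries.coeff_zero_eq_constantCoeff_apply, PowerSeries.coeff_mk, hp]
    exact one_ne_zero
  have h2 := congrArg (PowerSeries.coeff n) h
  rw [PowerSeries.coeff_mul] at h2
  simpa [Q] using h2

/-- The even moment of order `2 * k`, divided by `(2 * k)!`. -/
noncomputable def evenMoment (ν : Measure ℝ) (k : ℕ) : ℝ := ∫ x, x ^ (2 * k) / (2 * k).factorial ∂ν

theorem evenMoment_nonneg (ν : Measure ℝ) (k : ℕ) : 0 ≤ evenMoment ν k :=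
  integral_nonneg fun x => by
    have : 0 ≤ x ^ (2 * k) := by rw [pow_mul]; positivity
    positivity

theorem evenMoment_zero (ν : Measure ℝ) [IsProbabilityMeasure ν] : evenMoment ν 0 = 1 := by
  simp [evenMoment]

theorem integrable_even_pow_of_le {ν : Measure ℝ} [IsFiniteMeasure ν] {k N : ℕ} (hk : k ≤ N)
    (h : Integrable (fun x => x ^ (2 * N)) ν) : Integrable (fun x => x ^ (2 * k)) ν := by
  refine ((integrable_const (1 : ℝ)).add h).mono' (by fun_prop) (Filter.Eventually.of_forall ?_)
  intro x
  simp only [Pi.add_apply]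
  rw [pow_mul, pow_mul, Real.norm_of_nonneg (by positivity)]
  have h0 : 0 ≤ (x ^ 2) ^ N := by positivity
  rcases le_total (x ^ 2) 1 with h1 | h1
  · have : (x ^ 2) ^ k ≤ 1 := pow_le_one₀ (sq_nonneg x) h1
    linarith
  · have : (x ^ 2) ^ k ≤ (x ^ 2) ^ N := pow_le_pow_right₀ h1 hk
    linarith

theorem integrable_cosRem {ν : Measure ℝ} [IsFiniteMeasure ν] {N : ℕ}
    (h : Integrable (fun x => x ^ (2 * N)) ν) (t : ℝ) :
    Integrable (fun x => cosRem (N + 1) (t * x)) ν := by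
  refine (h.const_mul (2 * (t ^ (2 * N) / (2 * N).factorial))).mono'
    ((continuous_cosRem (N + 1)).comp (by fun_prop)).aestronglyMeasurable
    (Filter.Eventually.of_forall ?_)
  intro x
  rw [Real.norm_of_nonneg (cosRem_nonneg N _)]
  refine (cosRem_le N _).trans (le_of_eq ?_)
  rw [mul_pow]; ring

theorem integral_cos_eq_truncPoly_add {ν : Measure ℝ} [IsFiniteMeasure ν] {N : ℕ}
    (h : Integrable (fun x => x ^ (2 * N)) ν) (t : ℝ) :
    ∫ x, Real.cos (t * x) ∂ν =
      (truncPoly (fun k => (-1) ^ k * evenMoment ν k) N).eval (t ^ 2)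
        + (-1) ^ (N + 1) * ∫ x, cosRem (N + 1) (t * x) ∂ν := by
  have h1 : ∀ k ∈ Finset.range (N + 1), Integrable (fun x : ℝ =>
      (-1) ^ k * ((t * x) ^ (2 * k) / (2 * k).factorial)) ν := by
    intro k hk
    have hk : k ≤ N := Nat.lt_succ_iff.1 (Finset.mem_range.1 hk)
    simp_rw [mul_pow]
    exact (((integrable_even_pow_of_le hk h).const_mul _).div_const _).const_mul _
  simp_rw [cos_eq_sum_add_cosRem (N + 1)]
  rw [integral_add (integrable_finsetSum _ h1) ((integrable_cosRem h t).const_mul _),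
    integral_finsetSum _ h1, integral_const_mul, truncPoly, Polynomial.eval_finsetSum]
  congr 1
  refine Finset.sum_congr rfl fun k _ => ?_
  simp only [Polynomial.eval_mul, Polynomial.eval_C, Polynomial.eval_pow, Polynomial.eval_X,
    evenMoment]
  rw [integral_const_mul, mul_assoc, ← pow_mul, ← integral_mul_const]
  congr 1
  refine integral_congr_ae (Filter.Eventually.of_forall fun x => ?_)
  simp only [mul_pow]; ring

theorem isLittleO_integral_cosRem {ν : Measure ℝ} [IsFiniteMeasure ν] {N : ℕ}
    (h : Integrable (fun x => x ^ (2 * N)) ν) :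
    (fun t : ℝ => ∫ x, cosRem (N + 1) (t * x) ∂ν)
      =o[nhdsWithin 0 (Set.Ioi 0)] fun t : ℝ => t ^ (2 * N) := by
  have hpos : ∀ᶠ t : ℝ in nhdsWithin 0 (Set.Ioi 0), 0 < t := self_mem_nhdsWithin
  rw [Asymptotics.isLittleO_iff_tendsto' (by
    filter_upwards [hpos] with t ht h0
    exact absurd h0 (by positivity))]
  have key : Filter.Tendsto (fun t : ℝ => ∫ x, cosRem (N + 1) (t * x) / t ^ (2 * N) ∂ν)
      (nhdsWithin 0 (Set.Ioi 0)) (nhds (∫ _, (0 : ℝ) ∂ν)) := by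
    refine tendsto_integral_filter_of_dominated_convergence
      (fun x => 2 * (x ^ (2 * N) / (2 * N).factorial)) ?_ ?_
      ((h.div_const _).const_mul _) ?_
    · filter_upwards with t
      exact (((continuous_cosRem (N + 1)).comp (by fun_prop)).div_const _).aestronglyMeasurable
    · filter_upwards [hpos] with t ht
      filter_upwards with x
      have htp : 0 < t ^ (2 * N) := by positivity
      rw [Real.norm_of_nonneg (div_nonneg (cosRem_nonneg N _) htp.le), div_le_iff₀ htp]
      refine (cosRem_le N _).trans (le_of_eq ?_)
      rw [mul_pow]; ring
    · filter_upwards with x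
      have hup : Filter.Tendsto (fun t : ℝ => t ^ 2 * (x ^ (2 * N + 2) / (2 * N + 2).factorial))
          (nhdsWithin 0 (Set.Ioi 0)) (nhds 0) := by
        have : Continuous fun t : ℝ => t ^ 2 * (x ^ (2 * N + 2) / (2 * N + 2).factorial) := by
          fun_prop
        have h0 := this.tendsto 0
        norm_num at h0
        exact h0.mono_left nhdsWithin_le_nhds
      refine tendsto_of_tendsto_of_tendsto_of_le_of_le' tendsto_const_nhds hup ?_ ?_
      · filter_upwards [hpos] with t ht
        exact div_nonneg (cosRem_nonneg N _) (by positivity)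
      · filter_upwards [hpos] with t ht
        rw [div_le_iff₀ (by positivity)]
        refine (cosRem_le_succ N _).trans (le_of_eq ?_)
        rw [mul_pow]; ring
  simp_rw [integral_div] at key
  simpa using key

theorem integrable_even_pow_succ_of_le {ν : Measure ℝ} [IsFiniteMeasure ν] {N : ℕ}
    (h : Integrable (fun x => x ^ (2 * N)) ν) {u : ℝ → ℝ} {b : ℝ}
    (hu : Filter.Tendsto u (nhdsWithin 0 (Set.Ioi 0)) (nhds b))
    (hle : ∀ᶠ t in nhdsWithin (0 : ℝ) (Set.Ioi 0),
      ∫ x, cosRem (N + 1) (t * x) ∂ν ≤ u t * t ^ (2 * N + 2)) :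
    Integrable (fun x => x ^ (2 * (N + 1))) ν ∧ evenMoment ν (N + 1) ≤ b := by
  have hpos : ∀ᶠ t : ℝ in nhdsWithin 0 (Set.Ioi 0), 0 < t := self_mem_nhdsWithin
  have hxp : ∀ x : ℝ, 0 ≤ x ^ (2 * (N + 1)) / (2 * (N + 1)).factorial := fun x => by
    have : 0 ≤ x ^ (2 * (N + 1)) := by rw [pow_mul]; positivity
    positivity
  have hseq : Filter.Tendsto (fun n : ℕ => 1 / ((n : ℝ) + 1)) Filter.atTop
      (nhdsWithin 0 (Set.Ioi 0)) :=
    tendsto_nhdsWithin_iff.2 ⟨tendsto_one_div_add_atTop_nhds_zero_nat,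
      Filter.Eventually.of_forall fun n => by simp only [Set.mem_Ioi]; positivity⟩
  set F : ℕ → ℝ → ENNReal := fun n x => ENNReal.ofReal
    (cosRem (N + 1) (1 / ((n : ℝ) + 1) * x) / (1 / ((n : ℝ) + 1)) ^ (2 * N + 2)) with hF
  have hfat : ∫⁻ x, ENNReal.ofReal (x ^ (2 * (N + 1)) / (2 * (N + 1)).factorial) ∂ν
      ≤ ENNReal.ofReal b := by
    have h1 : ∀ x, Filter.liminf (fun n => F n x) Filter.atTop
        = ENNReal.ofReal (x ^ (2 * (N + 1)) / (2 * (N + 1)).factorial) := by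
      intro x
      exact ((ENNReal.continuous_ofReal.tendsto _).comp
        ((tendsto_cosRem_div N x).comp hseq)).liminf_eq
    simp_rw [← h1]
    refine (lintegral_liminf_le fun n => ?_).trans ?_
    · exact ENNReal.measurable_ofReal.comp
        (((continuous_cosRem (N + 1)).comp (by fun_prop)).div_const _).measurable
    have h2 : Filter.Tendsto (fun n : ℕ => ENNReal.ofReal (u (1 / ((n : ℝ) + 1)))) Filter.atTop
        (nhds (ENNReal.ofReal b)) :=
      (ENNReal.continuous_ofReal.tendsto _).comp (hu.comp hseq)
    rw [← h2.liminf_eq]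
    refine Filter.liminf_le_liminf ?_
    filter_upwards [hseq.eventually hle] with n hn
    have htp : 0 < (1 / ((n : ℝ) + 1)) ^ (2 * N + 2) := by positivity
    simp only [hF]
    rw [← ofReal_integral_eq_lintegral_ofReal ((integrable_cosRem h _).div_const _)
      (Filter.Eventually.of_forall fun x => div_nonneg (cosRem_nonneg N _) htp.le), integral_div]
    exact ENNReal.ofReal_le_ofReal ((div_le_iff₀ htp).2 hn)
  have hb : 0 ≤ b := by
    refine ge_of_tendsto hu ?_
    filter_upwards [hpos, hle] with t ht h1
    have h0 : 0 ≤ ∫ x, cosRem (N + 1) (t * x) ∂ν := integral_nonneg fun x => cosRem_nonneg N _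
    have htp : 0 < t ^ (2 * N + 2) := by positivity
    exact nonneg_of_mul_nonneg_left (h0.trans h1) htp
  have h_int : Integrable (fun x : ℝ => x ^ (2 * (N + 1)) / (2 * (N + 1)).factorial) ν := by
    refine (lintegral_ofReal_ne_top_iff_integrable (by fun_prop)
      (Filter.Eventually.of_forall hxp)).1 (hfat.trans_lt ENNReal.ofReal_lt_top).ne
  constructor
  · refine (h_int.mul_const ((2 * (N + 1)).factorial : ℝ)).congr
      (Filter.Eventually.of_forall fun x => ?_)
    simp only
    rw [div_mul_cancel₀]
    positivity
  · rw [evenMoment, integral_eq_lintegral_of_nonneg_ae (Filter.Eventually.of_forall hxp)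
      h_int.aestronglyMeasurable]
    exact ENNReal.toReal_le_of_le_ofReal hb hfat

theorem integrable_exp_abs_of_evenMoment_le {ν : Measure ℝ} [IsProbabilityMeasure ν]
    (h_int : ∀ N, Integrable (fun x => x ^ (2 * N)) ν) {ρ δ : ℝ} (hρ : 0 < ρ)
    (hle : ∀ n, evenMoment ν (n + 1) ≤ ρ ^ (n + 1)) (hδ : δ ^ 2 * ρ < 1) :
    Integrable (fun x => Real.exp (δ * |x|)) ν := by
  have hle' : ∀ n, evenMoment ν n ≤ ρ ^ n := by
    rintro (_ | n)
    · simp [evenMoment_zero]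
    · exact hle n
  have hterm : ∀ (n : ℕ) (x : ℝ), 0 ≤ (δ * x) ^ (2 * n) / (2 * n).factorial := fun n x => by
    have : 0 ≤ (δ * x) ^ (2 * n) := by rw [pow_mul]; positivity
    positivity
  have hcosh : Integrable (fun x => Real.cosh (δ * x)) ν := by
    refine (lintegral_ofReal_ne_top_iff_integrable (by fun_prop)
      (Filter.Eventually.of_forall fun x => (Real.cosh_pos _).le)).1 ?_
    have h1 : ∀ x : ℝ, ENNReal.ofReal (Real.cosh (δ * x))
        = ∑' n : ℕ, ENNReal.ofReal ((δ * x) ^ (2 * n) / (2 * n).factorial) := by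
      intro x
      rw [← ENNReal.ofReal_tsum_of_nonneg (fun n => hterm n x) (Real.hasSum_cosh _).summable,
        (Real.hasSum_cosh _).tsum_eq]
    simp_rw [h1]
    rw [lintegral_tsum fun n => by fun_prop]
    have h2 : ∀ n : ℕ, ∫⁻ x, ENNReal.ofReal ((δ * x) ^ (2 * n) / (2 * n).factorial) ∂ν
        ≤ ENNReal.ofReal ((δ ^ 2 * ρ) ^ n) := by
      intro n
      have h3 : ∀ x : ℝ, (δ * x) ^ (2 * n) / (2 * n).factorial
          = (δ ^ 2) ^ n * (x ^ (2 * n) / (2 * n).factorial) := fun x => by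
        rw [mul_pow, ← pow_mul]; ring
      rw [← ofReal_integral_eq_lintegral_ofReal]
      · simp_rw [h3]
        rw [integral_const_mul, mul_pow]
        exact ENNReal.ofReal_le_ofReal (mul_le_mul_of_nonneg_left (hle' n) (by positivity))
      · simp_rw [h3]
        exact ((h_int n).div_const _).const_mul _
      · exact Filter.Eventually.of_forall (hterm n)
    refine ((ENNReal.tsum_le_tsum h2).trans_lt ?_).ne
    exact ((summable_geometric_of_lt_one (by positivity) hδ).tsum_ofReal_ne_top).lt_top
  refine (hcosh.const_mul 2).mono' (by fun_prop) (Filter.Eventually.of_forall fun x => ?_)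
  rw [Real.norm_of_nonneg (Real.exp_pos _).le, Real.cosh_eq]
  have h1 := Real.exp_pos (δ * x)
  have h2 := Real.exp_pos (-(δ * x))
  rcases abs_cases x with ⟨h, _⟩ | ⟨h, _⟩
  · rw [h]; linarith
  · rw [h, mul_neg]; linarith

theorem exists_integrable_exp_abs_of_sum_log_integral_cos {ι : Type*} [Fintype ι] (α : ι → ℝ)
    (hα : ∀ i, 0 < α i) (c : ℝ) (ν : ι → Measure ℝ) [∀ i, IsProbabilityMeasure (ν i)]
    (heq : ∀ᶠ t in nhdsWithin (0 : ℝ) (Set.Ioi 0),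
      ∑ i, α i * Real.log (∫ x, Real.cos (t * x) ∂(ν i)) = -c * t ^ 2) :
    ∃ δ : ℝ, 0 < δ ∧ ∀ i, Integrable (fun x => Real.exp (δ * |x|)) (ν i) := by
  set p : ι → ℕ → ℝ := fun i k => (-1) ^ k * evenMoment (ν i) k with hp
  have hp0 : ∀ i, p i 0 = 1 := fun i => by simp [hp, evenMoment_zero]
  choose lam hlam using fun i => exists_logDeriv_coeff (p i) (hp0 i)
  have hconv : ∀ i N, ∑ k ∈ Finset.range N, lam i k * p i (N - k)
      = (N + 1) * p i (N + 1) - lam i N := by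
    intro i N
    have h := hlam i N
    rw [Finset.Nat.sum_antidiagonal_eq_sum_range_succ fun k l => lam i k * p i l,
      Finset.sum_range_succ, Nat.sub_self, hp0] at h
    linarith
  have step : ∀ N, (∀ i, Integrable (fun x => x ^ (2 * N)) (ν i)) → ∀ i,
      Integrable (fun x => x ^ (2 * (N + 1))) (ν i) ∧ evenMoment (ν i) (N + 1) ≤
        (-1) ^ (N + 1) * ((if N = 0 then -c else 0)
          - ∑ j, α j * (lam j N / (N + 1) - p j (N + 1))) / α i := by
    intro N hN i
    obtain ⟨u, hu, hle⟩ := remainder_le_of_sum_log_eq α hα c p lam hp0 hlam N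
      (fun i t => ∫ x, cosRem (N + 1) (t * x) ∂(ν i))
      (fun i t => integral_nonneg fun x => cosRem_nonneg N _)
      (fun i => isLittleO_integral_cosRem (hN i))
      (heq.mono fun t ht => by
        rw [← ht]
        exact Finset.sum_congr rfl fun j _ => by rw [integral_cos_eq_truncPoly_add (hN j)]) i
    exact integrable_even_pow_succ_of_le (hN i) hu hle
  have h_int : ∀ N i, Integrable (fun x => x ^ (2 * N)) (ν i) := by
    intro N
    induction N with
    | zero => intro i; simp
    | succ N ih => exact fun i => (step N ih i).1
  have habs : ∀ i k, |p i k| = evenMoment (ν i) k := fun i k => by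
    simp [hp, abs_mul, abs_of_nonneg (evenMoment_nonneg (ν i) k)]
  have hsum : ∀ i N, |∑ k ∈ Finset.range N, lam i k * p i (N - k)|
      ≤ ∑ k ∈ Finset.range N, |lam i k| * evenMoment (ν i) (N - k) := fun i N => by
    refine (Finset.abs_sum_le_sum_abs _ _).trans_eq (Finset.sum_congr rfl fun k _ => ?_)
    rw [abs_mul, habs]
  obtain ⟨ρ, hρ, hle⟩ := exists_geometric_bound α hα (fun i => evenMoment (ν i)) lam
    (fun i => evenMoment_nonneg (ν i)) (by
      intro N hN i
      have h := (step N (h_int N) i).2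
      rw [if_neg (by omega), le_div_iff₀ (hα i)] at h
      have hN0 : (0 : ℝ) < N + 1 := by positivity
      have h2 : ((N : ℝ) + 1) * ((-1) ^ (N + 1) * (0 - ∑ j, α j * (lam j N / (N + 1) - p j (N + 1))))
          = (-1) ^ (N + 1) * ∑ j, α j * ∑ k ∈ Finset.range N, lam j k * p j (N - k) := by
        simp_rw [hconv]
        rw [mul_left_comm, zero_sub, ← Finset.sum_neg_distrib, Finset.mul_sum]
        congr 1
        refine Finset.sum_congr rfl fun j _ => ?_
        field_simp
        ring
      calc _ = ((N : ℝ) + 1) * (evenMoment (ν i) (N + 1) * α i) := by ring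
        _ ≤ _ := mul_le_mul_of_nonneg_left h hN0.le
        _ = _ := h2
        _ ≤ |∑ j, α j * ∑ k ∈ Finset.range N, lam j k * p j (N - k)| := by
          refine (le_abs_self _).trans_eq ?_
          rw [abs_mul]; simp
        _ ≤ _ := by
          refine (Finset.abs_sum_le_sum_abs _ _).trans (Finset.sum_le_sum fun j _ => ?_)
          rw [abs_mul, abs_of_pos (hα j)]
          exact mul_le_mul_of_nonneg_left (hsum j N) (hα j).le)
    (by
      intro N i
      have h : lam i N = (N + 1) * p i (N + 1) - ∑ k ∈ Finset.range N, lam i k * p i (N - k) := by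
        rw [hconv]; ring
      have hN0 : (0 : ℝ) < N + 1 := by positivity
      calc |lam i N| ≤ |(N + 1) * p i (N + 1)| + |∑ k ∈ Finset.range N, lam i k * p i (N - k)| := by
            rw [h]; exact abs_sub _ _
        _ ≤ _ := by
            rw [abs_mul, habs, abs_of_pos hN0]
            exact add_le_add le_rfl (hsum i N))
  have hρ1 : (0 : ℝ) < ρ + 1 := by positivity
  refine ⟨1 / Real.sqrt (ρ + 1), by positivity, fun i =>
    integrable_exp_abs_of_evenMoment_le (fun N => h_int N i) hρ (hle i) ?_⟩
  rw [div_pow, Real.sq_sqrt hρ1.le, one_pow, one_div_mul_eq_div, div_lt_one hρ1]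
  linarith

/-- The law of `X - Y` where `X`, `Y` are independent with law `μ`. -/
noncomputable def symmetrization (μ : Measure ℝ) : Measure ℝ := μ.conv (μ.map fun x => -x)

instance isProbabilityMeasure_symmetrization (μ : Measure ℝ) [IsProbabilityMeasure μ] :
    IsProbabilityMeasure (symmetrization μ) := by
  have : IsProbabilityMeasure (μ.map fun x => -x) :=
    Measure.isProbabilityMeasure_map (by fun_prop)
  unfold symmetrization
  infer_instance

theorem symmetrization_eq_map (μ : Measure ℝ) [IsProbabilityMeasure μ] :
    symmetrization μ = (μ.prod μ).map fun x => x.1 - x.2 := by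
  have h : μ.prod (μ.map fun x => -x) = (μ.prod μ).map (Prod.map id fun x => -x) := by
    rw [← Measure.map_prod_map μ μ measurable_id measurable_neg, Measure.map_id]
  rw [symmetrization, Measure.conv, h, Measure.map_map (by fun_prop) (by fun_prop)]
  rfl

theorem charFun_symmetrization (μ : Measure ℝ) [IsProbabilityMeasure μ] (t : ℝ) :
    charFun (symmetrization μ) t = ((‖charFun μ t‖ ^ 2 : ℝ) : ℂ) := by
  have h : charFun (μ.map fun x => -x) t = charFun μ (-t) := by
    have := charFun_map_mul (μ := μ) (-1) t
    simpa using this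
  have : IsProbabilityMeasure (μ.map fun x => -x) :=
    Measure.isProbabilityMeasure_map (by fun_prop)
  rw [symmetrization, charFun_conv, h, charFun_neg, Complex.mul_conj, Complex.normSq_eq_norm_sq]

theorem integral_cos_eq_re_charFun (ν : Measure ℝ) [IsProbabilityMeasure ν] (t : ℝ) :
    ∫ x, Real.cos (t * x) ∂ν = (charFun ν t).re := by
  have h_int : Integrable (fun x : ℝ => Complex.exp (t * x * Complex.I)) ν := by
    refine (integrable_const (1 : ℝ)).mono' (by fun_prop) (Filter.Eventually.of_forall fun x => ?_)
    rw [← Complex.ofReal_mul, Complex.norm_exp_ofReal_mul_I]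
  have h : (∫ x : ℝ, Complex.exp (t * x * Complex.I) ∂ν).re
      = ∫ x : ℝ, (Complex.exp (t * x * Complex.I)).re ∂ν := (integral_re h_int).symm
  rw [charFun_apply_real, h]
  refine integral_congr_ae (Filter.Eventually.of_forall fun x => ?_)
  simp only
  rw [← Complex.ofReal_mul, Complex.exp_ofReal_mul_I_re]

theorem complexMGF_symmetrization (μ : Measure ℝ) [IsProbabilityMeasure μ] (z : ℂ) :
    complexMGF id (symmetrization μ) z = complexMGF id μ z * complexMGF id μ (-z) := by
  rw [symmetrization_eq_map, complexMGF_id_map (by fun_prop)]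
  simp only [complexMGF, id_eq]
  rw [← integral_prod_mul]
  refine integral_congr_ae (Filter.Eventually.of_forall fun x => ?_)
  simp only [Complex.ofReal_sub]
  rw [← Complex.exp_add]
  ring_nf

theorem mgf_symmetrization (μ : Measure ℝ) [IsProbabilityMeasure μ] (y : ℝ) :
    mgf id (symmetrization μ) y = mgf id μ y * mgf id μ (-y) := by
  have h := complexMGF_symmetrization μ y
  rw [← Complex.ofReal_neg, complexMGF_ofReal, complexMGF_ofReal, complexMGF_ofReal] at h
  exact_mod_cast h

theorem mem_integrableExpSet_of_symmetrization {μ : Measure ℝ} [IsProbabilityMeasure μ] {y : ℝ}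
    (h : y ∈ integrableExpSet id (symmetrization μ)) : y ∈ integrableExpSet id μ := by
  have h : Integrable (fun x : ℝ => Real.exp (y * x)) (symmetrization μ) := h
  rw [symmetrization_eq_map, integrable_map_measure (by fun_prop) (by fun_prop)] at h
  obtain ⟨v, hv⟩ := h.prod_left_ae.exists
  refine Integrable.congr (hv.const_mul (Real.exp (y * v))) (Filter.Eventually.of_forall fun x => ?_)
  simp only [Function.comp, id_eq]
  rw [← Real.exp_add]
  ring_nf

theorem map_neg_symmetrization (μ : Measure ℝ) [IsProbabilityMeasure μ] :
    (symmetrization μ).map (fun x => -x) = symmetrization μ := by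
  refine Measure.ext_of_charFun (funext fun t => ?_)
  have := charFun_map_mul (μ := symmetrization μ) (-1) t
  simp only [neg_mul, one_mul] at this
  rw [this, charFun_neg, charFun_symmetrization, Complex.conj_ofReal]

theorem neg_mem_integrableExpSet_symmetrization {μ : Measure ℝ} [IsProbabilityMeasure μ] {y : ℝ}
    (h : y ∈ integrableExpSet id (symmetrization μ)) :
    -y ∈ integrableExpSet id (symmetrization μ) := by
  have h : Integrable (fun x : ℝ => Real.exp (y * x)) (symmetrization μ) := h
  rw [← map_neg_symmetrization, integrable_map_measure (by fun_prop) (by fun_prop)] at h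
  refine h.congr (Filter.Eventually.of_forall fun x => ?_)
  simp [Function.comp]

theorem mgf_symmetrization_neg (μ : Measure ℝ) [IsProbabilityMeasure μ] (y : ℝ) :
    mgf id (symmetrization μ) (-y) = mgf id (symmetrization μ) y := by
  rw [mgf_symmetrization, mgf_symmetrization, neg_neg, mul_comm]

theorem one_le_mgf_symmetrization {μ : Measure ℝ} [IsProbabilityMeasure μ] {y : ℝ}
    (h : y ∈ integrableExpSet id (symmetrization μ)) : 1 ≤ mgf id (symmetrization μ) y := by
  have h1 : Integrable (fun x : ℝ => Real.exp (y * x)) (symmetrization μ) := h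
  have h2 : Integrable (fun x : ℝ => Real.exp (-y * x)) (symmetrization μ) :=
    neg_mem_integrableExpSet_symmetrization h
  have h3 : mgf id (symmetrization μ) y + mgf id (symmetrization μ) (-y)
      = ∫ x, (Real.exp (y * x) + Real.exp (-y * x)) ∂(symmetrization μ) :=
    (integral_add h1 h2).symm
  have h4 : ∫ _, (2 : ℝ) ∂(symmetrization μ)
      ≤ ∫ x, (Real.exp (y * x) + Real.exp (-y * x)) ∂(symmetrization μ) := by
    refine integral_mono (integrable_const _) (h1.add h2) fun x => ?_
    have := Real.one_le_cosh (y * x)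
    rw [Real.cosh_eq] at this
    simp only [neg_mul]
    linarith
  rw [mgf_symmetrization_neg] at h3
  simp only [integral_const, probReal_univ, smul_eq_mul, one_mul] at h4
  linarith

theorem exists_mem_integrableExpSet_symmetrization {ι : Type*} [Fintype ι] (α : ι → ℝ)
    (hα : ∀ i, 0 < α i) (c : ℝ) (μ : ι → Measure ℝ) [∀ i, IsProbabilityMeasure (μ i)]
    (heq : ∀ᶠ t in nhdsWithin (0 : ℝ) (Set.Ioi 0),
      ∑ i, α i * Real.log ‖charFun (μ i) t‖ = -c * t ^ 2) :
    ∃ δ : ℝ, 0 < δ ∧ ∀ i, δ ∈ integrableExpSet id (symmetrization (μ i)) := by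
  obtain ⟨δ, hδ, h⟩ := exists_integrable_exp_abs_of_sum_log_integral_cos α hα (2 * c)
    (fun i => symmetrization (μ i)) (heq.mono fun t ht => by
      simp_rw [integral_cos_eq_re_charFun, charFun_symmetrization, Complex.ofReal_re, Real.log_pow]
      rw [show -(2 * c) * t ^ 2 = 2 * (-c * t ^ 2) by ring, ← ht, Finset.mul_sum]
      exact Finset.sum_congr rfl fun i _ => by push_cast; ring)
  refine ⟨δ, hδ, fun i => ?_⟩
  refine (h i).mono' (by fun_prop) (Filter.Eventually.of_forall fun x => ?_)
  rw [Real.norm_of_nonneg (Real.exp_pos _).le, Real.exp_le_exp]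
  exact mul_le_mul_of_nonneg_left (le_abs_self x) hδ.le

theorem eventually_sum_log_norm_eq {ι : Type*} [Fintype ι] (α : ι → ℝ) (K : ℝ) (F : ι → ℂ → ℂ)
    (hF : ∀ i, AnalyticAt ℂ (F i) 0) (hF0 : ∀ i, F i 0 = 1)
    (hreal : ∀ i (t : ℝ), F i (t * Complex.I) = (‖F i (t * Complex.I)‖ : ℂ))
    (heq : ∀ᶠ t : ℝ in nhdsWithin 0 (Set.Ioi 0),
      ∑ i, α i * Real.log ‖F i (t * Complex.I)‖ = -K * t ^ 2) :
    ∀ᶠ z in nhds (0 : ℂ), ∑ i, α i * Real.log ‖F i z‖ = ((K : ℂ) * z ^ 2).re := by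
  set Λ : ℂ → ℂ := fun z => ∑ i, (α i : ℂ) * Complex.log (F i z) - K * z ^ 2 with hΛ
  have hΛa : AnalyticAt ℂ Λ 0 := by
    refine AnalyticAt.sub (Finset.analyticAt_fun_sum _ fun i _ => ?_) (by fun_prop)
    exact analyticAt_const.mul ((hF i).clog (by rw [hF0]; exact Complex.one_mem_slitPlane))
  have htend : Filter.Tendsto (fun t : ℝ => (t : ℂ) * Complex.I) (nhdsWithin 0 (Set.Ioi 0))
      (nhdsWithin 0 {0}ᶜ) := by
    refine tendsto_nhdsWithin_iff.2 ⟨?_, ?_⟩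
    · have : Continuous fun t : ℝ => (t : ℂ) * Complex.I := by fun_prop
      have h := this.tendsto 0
      simp only [Complex.ofReal_zero, zero_mul] at h
      exact h.mono_left nhdsWithin_le_nhds
    · filter_upwards [self_mem_nhdsWithin] with t ht
      have : t ≠ 0 := ne_of_gt ht
      simpa using this
  have hfreq : ∃ᶠ z in nhdsWithin (0 : ℂ) {0}ᶜ, Λ z = 0 := by
    refine htend.frequently (Filter.Eventually.frequently ?_)
    filter_upwards [heq] with t ht
    have h1 : ∀ i, Complex.log (F i (t * Complex.I))
        = (Real.log ‖F i (t * Complex.I)‖ : ℝ) := by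
      intro i
      rw [Complex.ofReal_log (norm_nonneg _), ← hreal]
    simp only [hΛ, h1]
    rw [mul_pow, Complex.I_sq]
    have h2 := congrArg (fun x : ℝ => (x : ℂ)) ht
    simp only [Complex.ofReal_sum, Complex.ofReal_mul, Complex.ofReal_neg,
      Complex.ofReal_pow] at h2
    rw [h2]; ring
  filter_upwards [hΛa.frequently_zero_iff_eventually_zero.1 hfreq] with z hz
  have h := congrArg Complex.re (sub_eq_zero.1 hz)
  rw [← h, Complex.re_sum]
  refine Finset.sum_congr rfl fun i _ => ?_
  rw [Complex.re_ofReal_mul, Complex.log_re]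

theorem ne_zero_and_sum_log_norm_eq {ι : Type*} [Fintype ι] (α : ι → ℝ) (hα : ∀ i, 0 < α i) (K : ℝ)
    (F : ι → ℂ → ℂ) {U : Set ℂ} (hU : IsOpen U) (hUc : IsPreconnected U) (h0 : 0 ∈ U)
    (hF : ∀ i, DifferentiableOn ℂ (F i) U) (hF0 : ∀ i, F i 0 = 1)
    (heq : ∀ᶠ z in nhds (0 : ℂ), ∑ i, α i * Real.log ‖F i z‖ = ((K : ℂ) * z ^ 2).re) :
    ∀ z ∈ U, (∀ i, F i z ≠ 0) ∧ ∑ i, α i * Real.log ‖F i z‖ = ((K : ℂ) * z ^ 2).re := by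
  have hcont : ∀ z ∈ U, ∀ i, ContinuousAt (F i) z := fun z hz i =>
    ((hF i).differentiableAt (hU.mem_nhds hz)).continuousAt
  have hnz : ∀ z, (∀ i, F i z ≠ 0) →
      ∏ i, ‖F i z‖ ^ α i = Real.exp (∑ i, α i * Real.log ‖F i z‖) := by
    intro z hz
    rw [Real.exp_sum]
    refine Finset.prod_congr rfl fun i _ => ?_
    rw [Real.rpow_def_of_pos (norm_pos_iff.2 (hz i)), mul_comm]
  have hne_of : ∀ z, ∏ i, ‖F i z‖ ^ α i = Real.exp ((K : ℂ) * z ^ 2).re → ∀ i, F i z ≠ 0 := by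
    intro z hz i hi
    have : ∏ i, ‖F i z‖ ^ α i = 0 := by
      refine Finset.prod_eq_zero (Finset.mem_univ i) ?_
      rw [hi, norm_zero, Real.zero_rpow (hα i).ne']
    exact (Real.exp_pos _).ne' (hz.symm.trans this)
  have hlog_of : ∀ z, ∏ i, ‖F i z‖ ^ α i = Real.exp ((K : ℂ) * z ^ 2).re →
      ∑ i, α i * Real.log ‖F i z‖ = ((K : ℂ) * z ^ 2).re := by
    intro z hz
    rw [hnz z (hne_of z hz)] at hz
    exact Real.exp_injective hz
  set P : ℂ → Prop := fun z => ∏ i, ‖F i z‖ ^ α i = Real.exp ((K : ℂ) * z ^ 2).re with hP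
  set V : Set ℂ := {z | ∀ᶠ w in nhds z, P w} with hV
  have hVo : IsOpen V := isOpen_setOfPred_eventually_nhds
  have h0V : (0 : ℂ) ∈ V := by
    have hev : ∀ᶠ z in nhds (0 : ℂ), ∀ i, F i z ≠ 0 := by
      rw [Filter.eventually_all]
      exact fun i => (hcont 0 h0 i).eventually_ne (by rw [hF0]; exact one_ne_zero)
    show ∀ᶠ z in nhds (0 : ℂ), P z
    filter_upwards [hev, heq] with z h1 h2
    simp only [hP]
    rw [hnz z h1, h2]
  have hsub : U ⊆ V := by
    refine hUc.subset_of_closure_inter_subset hVo ⟨0, h0, h0V⟩ ?_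
    rintro z ⟨hzV, hzU⟩
    have hPz : P z := by
      by_contra hne
      have hc1 : ContinuousAt (fun w => ∏ i, ‖F i w‖ ^ α i) z := by
        refine tendsto_finsetProd _ fun i _ => ?_
        exact ((hcont z hzU i).norm).rpow_const (Or.inr (hα i).le)
      have hc2 : ContinuousAt (fun w : ℂ => Real.exp ((K : ℂ) * w ^ 2).re) z := by fun_prop
      have hev : ∀ᶠ w in nhds z, ¬ P w := (hc1.ne_iff_eventually_ne hc2).1 hne
      obtain ⟨w, hw, hwV⟩ := ((mem_closure_iff_frequently.1 hzV).and_eventually hev).exists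
      exact hwV (Filter.Eventually.self_of_nhds hw)
    have hev : ∀ᶠ w in nhds z, w ∈ U ∧ ∀ i, F i w ≠ 0 := by
      refine Filter.Eventually.and (hU.mem_nhds hzU) (Filter.eventually_all.2 fun i => ?_)
      exact (hcont z hzU i).eventually_ne (hne_of z hPz i)
    obtain ⟨r, hr, hball⟩ := Metric.eventually_nhds_iff_ball.1 hev
    set q : ℂ → ℝ := fun w => ∑ i, α i * Real.log ‖F i w‖ - ((K : ℂ) * w ^ 2).re with hq
    have hqa : AnalyticOnNhd ℝ q (Metric.ball z r) := by
      intro w hw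
      obtain ⟨hwU, hw0⟩ := hball w hw
      refine AnalyticAt.sub (Finset.analyticAt_fun_sum _ fun i _ => ?_) ?_
      · exact analyticAt_const.mul (HarmonicAt.analyticAt
          (((hF i).analyticAt (hU.mem_nhds hwU)).harmonicAt_log_norm (hw0 i)))
      · have h1 : AnalyticAt ℂ (fun w : ℂ => (K : ℂ) * w ^ 2) w := by fun_prop
        exact (Complex.reCLM.analyticAt _).comp h1.restrictScalars
    obtain ⟨w, hwb, hwV⟩ := mem_closure_iff_nhds.1 hzV _ (Metric.ball_mem_nhds z hr)
    have hq0 : q =ᶠ[nhds w] 0 := by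
      filter_upwards [show ∀ᶠ v in nhds w, P v from hwV] with v hv
      simp only [hq, Pi.zero_apply]
      rw [hlog_of v hv, sub_self]
    have hqz := hqa.eqOn_zero_of_preconnected_of_eventuallyEq_zero
      (convex_ball z r).isPreconnected hwb hq0
    show ∀ᶠ v in nhds z, P v
    filter_upwards [Metric.ball_mem_nhds z hr] with v hv
    simp only [hP]
    rw [hnz v (hball v hv).2]
    congr 1
    exact sub_eq_zero.1 (hqz hv)
  intro z hz
  have hPz : P z := (hsub hz).self_of_nhds
  exact ⟨hne_of z hPz, hlog_of z hPz⟩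

theorem complexMGF_symmetrization_mul_I (μ : Measure ℝ) [IsProbabilityMeasure μ] (t : ℝ) :
    complexMGF id (symmetrization μ) (t * Complex.I) = ((‖charFun μ t‖ ^ 2 : ℝ) : ℂ) := by
  rw [complexMGF_id_mul_I, charFun_symmetrization]

theorem complexMGF_ne_zero_and_sum_log_norm_eq {ι : Type*} [Fintype ι] (α : ι → ℝ)
    (hα : ∀ i, 0 < α i) (c : ℝ) (μ : ι → Measure ℝ) [∀ i, IsProbabilityMeasure (μ i)]
    (heq : ∀ᶠ t in nhdsWithin (0 : ℝ) (Set.Ioi 0),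
      ∑ i, α i * Real.log ‖charFun (μ i) t‖ = -c * t ^ 2)
    {R : ℝ} (hR : 0 < R)
    (h_int : ∀ r ∈ Set.Ioo (-R) R, ∀ i, r ∈ integrableExpSet id (symmetrization (μ i)))
    {z : ℂ} (hz : z.re ∈ Set.Ioo (-R) R) :
    (∀ i, complexMGF id (symmetrization (μ i)) z ≠ 0) ∧
      ∑ i, α i * Real.log ‖complexMGF id (symmetrization (μ i)) z‖
        = (((2 * c : ℝ) : ℂ) * z ^ 2).re := by
  set U : Set ℂ := Complex.re ⁻¹' Set.Ioo (-R) R with hUdef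
  have hU : IsOpen U := isOpen_Ioo.preimage Complex.continuous_re
  have hUc : IsPreconnected U :=
    ((convex_Ioo (-R) R).linear_preimage Complex.reCLM.toLinearMap).isPreconnected
  have h0 : (0 : ℂ) ∈ U := by simp [hUdef, hR]
  have hF : ∀ i, DifferentiableOn ℂ (complexMGF id (symmetrization (μ i))) U := by
    intro i
    refine differentiableOn_complexMGF.mono fun z hz => ?_
    exact interior_maximal (fun r hr => h_int r hr i) isOpen_Ioo hz
  have hF0 : ∀ i, complexMGF id (symmetrization (μ i)) 0 = 1 := fun i => by simp [complexMGF]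
  refine ne_zero_and_sum_log_norm_eq α hα (2 * c) _ hU hUc h0 hF hF0 ?_ z hz
  refine eventually_sum_log_norm_eq α (2 * c) _ (fun i => (hF i).analyticAt (hU.mem_nhds h0)) hF0
    (fun i t => ?_) ?_
  · rw [complexMGF_symmetrization_mul_I, Complex.norm_real, Real.norm_of_nonneg (by positivity)]
  · filter_upwards [heq] with t ht
    simp_rw [complexMGF_symmetrization_mul_I, Complex.norm_real, norm_pow, norm_norm, Real.log_pow]
    rw [show -(2 * c) * t ^ 2 = 2 * (-c * t ^ 2) by ring, ← ht, Finset.mul_sum]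
    exact Finset.sum_congr rfl fun i _ => by push_cast; ring

theorem mem_integrableExpSet_of_mgf_le {ν : Measure ℝ} [IsProbabilityMeasure ν] {R C : ℝ}
    (hR : 0 < R) (h_int : ∀ r ∈ Set.Ioo 0 R, r ∈ integrableExpSet id ν)
    (hle : ∀ r ∈ Set.Ioo 0 R, mgf id ν r ≤ C) : R ∈ integrableExpSet id ν := by
  have hseq : Filter.Tendsto (fun n : ℕ => R * (1 - 1 / ((n : ℝ) + 2))) Filter.atTop (nhds R) := by
    have h1 : Filter.Tendsto (fun n : ℕ => 1 / ((n : ℝ) + 2)) Filter.atTop (nhds 0) := by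
      have := (Filter.tendsto_add_atTop_iff_nat 1).2
        (tendsto_one_div_add_atTop_nhds_zero_nat (𝕜 := ℝ))
      refine this.congr fun n => ?_
      push_cast
      ring
    simpa using (h1.const_sub 1).const_mul R
  have hmem : ∀ n : ℕ, R * (1 - 1 / ((n : ℝ) + 2)) ∈ Set.Ioo 0 R := by
    intro n
    have h2 : (0 : ℝ) < 1 / ((n : ℝ) + 2) := by positivity
    have h3 : 1 / ((n : ℝ) + 2) < 1 := by
      rw [div_lt_one (by positivity)]
      have : (0 : ℝ) ≤ n := by positivity
      linarith
    constructor
    · exact mul_pos hR (by linarith)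
    · nlinarith
  refine (lintegral_ofReal_ne_top_iff_integrable (by fun_prop)
    (Filter.Eventually.of_forall fun x => (Real.exp_pos _).le)).1 ?_
  have h1 : ∀ x : ℝ, Filter.liminf (fun n : ℕ => ENNReal.ofReal
      (Real.exp (R * (1 - 1 / ((n : ℝ) + 2)) * x))) Filter.atTop
      = ENNReal.ofReal (Real.exp (R * id x)) := by
    intro x
    exact ((ENNReal.continuous_ofReal.tendsto _).comp
      ((Real.continuous_exp.tendsto _).comp (hseq.mul_const x))).liminf_eq
  simp_rw [← h1]
  refine ((lintegral_liminf_le fun n => ?_).trans ?_).trans_lt (ENNReal.ofReal_lt_top (r := C)) |>.ne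
  · fun_prop
  refine Filter.liminf_le_of_le (by isBoundedDefault) fun b hb => ?_
  obtain ⟨n, hn⟩ := hb.exists
  refine hn.trans ?_
  have h2 : Integrable (fun x : ℝ => Real.exp (R * (1 - 1 / ((n : ℝ) + 2)) * x)) ν :=
    h_int _ (hmem n)
  rw [← ofReal_integral_eq_lintegral_ofReal h2
    (Filter.Eventually.of_forall fun x => (Real.exp_pos _).le)]
  exact ENNReal.ofReal_le_ofReal (hle _ (hmem n))

theorem tendsto_complexMGF_nhdsLT {ν : Measure ℝ} [IsProbabilityMeasure ν] {R : ℝ} (hR : 0 < R)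
    (h : R ∈ integrableExpSet id ν) (t : ℝ) :
    Filter.Tendsto (fun y : ℝ => complexMGF id ν (y + t * Complex.I)) (nhdsWithin R (Set.Iio R))
      (nhds (complexMGF id ν (R + t * Complex.I))) := by
  have h : Integrable (fun x : ℝ => Real.exp (R * x)) ν := h
  refine tendsto_integral_filter_of_dominated_convergence (fun x => 1 + Real.exp (R * x)) ?_ ?_
    ((integrable_const _).add h) ?_
  · exact Filter.Eventually.of_forall fun y => by fun_prop
  · filter_upwards [Ioo_mem_nhdsLT hR] with y hy
    filter_upwards with x
    rw [Complex.norm_exp]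
    have : ((y + t * Complex.I) * ((id x : ℝ) : ℂ)).re = y * x := by simp
    rw [this]
    have h1 := Real.exp_pos (R * x)
    rcases le_total 0 x with hx | hx
    · have : Real.exp (y * x) ≤ Real.exp (R * x) :=
        Real.exp_le_exp.2 (mul_le_mul_of_nonneg_right hy.2.le hx)
      linarith
    · have : Real.exp (y * x) ≤ 1 :=
        Real.exp_le_one_iff.2 (mul_nonpos_of_nonneg_of_nonpos hy.1.le hx)
      linarith
  · filter_upwards with x
    have : Continuous fun y : ℝ => Complex.exp ((y + t * Complex.I) * ((id x : ℝ) : ℂ)) := by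
      fun_prop
    exact (this.tendsto R).mono_left nhdsWithin_le_nhds

theorem charFun_tilted_mul (ν : Measure ℝ) (R t : ℝ) :
    charFun (ν.tilted fun x => R * x) t
      = complexMGF id ν (R + t * Complex.I) / (mgf id ν R : ℂ) := by
  rw [charFun_apply_real, integral_tilted, complexMGF, ← integral_div]
  refine integral_congr_ae (Filter.Eventually.of_forall fun x => ?_)
  simp only [Complex.real_smul, mgf, id_eq]
  push_cast
  rw [div_mul_eq_mul_div, ← Complex.exp_add]
  ring_nf

theorem add_mem_integrableExpSet_of_tilted {ν : Measure ℝ} {R δ : ℝ}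
    (h : R ∈ integrableExpSet id ν) (hδ : δ ∈ integrableExpSet id (ν.tilted fun x => R * x)) :
    R + δ ∈ integrableExpSet id ν := by
  have h : Integrable (fun x : ℝ => Real.exp (R * x)) ν := h
  have hδ : Integrable (fun x : ℝ => Real.exp (δ * x)) (ν.tilted fun x => R * x) := hδ
  rw [integrable_tilted_iff h] at hδ
  refine hδ.congr (Filter.Eventually.of_forall fun x => ?_)
  simp only [smul_eq_mul, id_eq]
  rw [← Real.exp_add, add_mul]

theorem exists_add_mem_integrableExpSet {ι : Type*} [Fintype ι] (α : ι → ℝ)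
    (hα : ∀ i, 0 < α i) (c : ℝ) (μ : ι → Measure ℝ) [∀ i, IsProbabilityMeasure (μ i)]
    (heq : ∀ᶠ t in nhdsWithin (0 : ℝ) (Set.Ioi 0),
      ∑ i, α i * Real.log ‖charFun (μ i) t‖ = -c * t ^ 2)
    {R : ℝ} (hR : 0 < R)
    (h_int : ∀ r ∈ Set.Ioo (-R) R, ∀ i, r ∈ integrableExpSet id (symmetrization (μ i))) :
    ∃ δ : ℝ, 0 < δ ∧ ∀ i, R + δ ∈ integrableExpSet id (symmetrization (μ i)) := by
  have hstrip : ∀ y ∈ Set.Ioo 0 R, ∀ t : ℝ,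
      ∑ i, α i * Real.log ‖complexMGF id (symmetrization (μ i)) (y + t * Complex.I)‖
        = 2 * c * (y ^ 2 - t ^ 2) := by
    intro y hy t
    rw [(complexMGF_ne_zero_and_sum_log_norm_eq α hα c μ heq hR h_int (z := y + t * Complex.I)
      (by simp only [Complex.add_re, Complex.ofReal_re, Complex.mul_re, Complex.I_re, mul_zero,
            Complex.ofReal_im, zero_mul, sub_zero, add_zero]
          exact ⟨by linarith [hy.1], hy.2⟩)).2, Complex.re_ofReal_mul]
    simp [pow_two]
  have hone : ∀ i, ∀ r ∈ Set.Ioo 0 R, 1 ≤ mgf id (symmetrization (μ i)) r := fun i r hr =>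
    one_le_mgf_symmetrization (h_int r ⟨by linarith [hr.1], hr.2⟩ i)
  have hmemR : ∀ i, R ∈ integrableExpSet id (symmetrization (μ i)) := by
    intro i
    refine mem_integrableExpSet_of_mgf_le (C := Real.exp (|2 * c| * R ^ 2 / α i)) hR
      (fun r hr => h_int r ⟨by linarith [hr.1], hr.2⟩ i) fun r hr => ?_
    have h1 := hstrip r hr 0
    simp only [Complex.ofReal_zero, zero_mul, add_zero, complexMGF_ofReal, Complex.norm_real] at h1
    have h2 : α i * Real.log (mgf id (symmetrization (μ i)) r) ≤ 2 * c * (r ^ 2 - 0 ^ 2) := by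
      rw [← h1]
      have h3 : ∀ j, ‖mgf id (symmetrization (μ j)) r‖ = mgf id (symmetrization (μ j)) r :=
        fun j => Real.norm_of_nonneg (by linarith [hone j r hr])
      simp_rw [h3]
      exact Finset.single_le_sum (f := fun j => α j * Real.log (mgf id (symmetrization (μ j)) r))
        (fun j _ => mul_nonneg (hα j).le (Real.log_nonneg (hone j r hr))) (Finset.mem_univ i)
    rw [← Real.exp_log (show 0 < mgf id (symmetrization (μ i)) r by linarith [hone i r hr]),
      Real.exp_le_exp, le_div_iff₀ (hα i)]
    have h4 : 2 * c * (r ^ 2 - 0 ^ 2) ≤ |2 * c| * R ^ 2 := by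
      have h5 : r ^ 2 - 0 ^ 2 ≤ R ^ 2 := by nlinarith [hr.1, hr.2]
      have h6 : 0 ≤ r ^ 2 - 0 ^ 2 := by nlinarith [hr.1, hr.2]
      exact (mul_le_mul_of_nonneg_right (le_abs_self _) h6).trans
        (mul_le_mul_of_nonneg_left h5 (abs_nonneg _))
    linarith
  have hpos : ∀ i, 0 < mgf id (symmetrization (μ i)) R := fun i => by
    linarith [one_le_mgf_symmetrization (hmemR i)]
  have hbdry : ∀ t : ℝ, (∀ i, complexMGF id (symmetrization (μ i)) (R + t * Complex.I) ≠ 0) →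
      ∑ i, α i * Real.log ‖complexMGF id (symmetrization (μ i)) (R + t * Complex.I)‖
        = 2 * c * (R ^ 2 - t ^ 2) := by
    intro t ht
    have h1 : Filter.Tendsto (fun y : ℝ => ∑ i, α i * Real.log
        ‖complexMGF id (symmetrization (μ i)) (y + t * Complex.I)‖) (nhdsWithin R (Set.Iio R))
        (nhds (∑ i, α i * Real.log
          ‖complexMGF id (symmetrization (μ i)) (R + t * Complex.I)‖)) :=
      tendsto_finsetSum _ fun i _ => (((tendsto_complexMGF_nhdsLT hR (hmemR i) t).norm).log
        (norm_ne_zero_iff.2 (ht i))).const_mul _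
    have h2 : Filter.Tendsto (fun y : ℝ => 2 * c * (y ^ 2 - t ^ 2)) (nhdsWithin R (Set.Iio R))
        (nhds (2 * c * (R ^ 2 - t ^ 2))) := by
      have : Continuous fun y : ℝ => 2 * c * (y ^ 2 - t ^ 2) := by fun_prop
      exact (this.tendsto R).mono_left nhdsWithin_le_nhds
    refine tendsto_nhds_unique (h1.congr' ?_) h2
    filter_upwards [Ioo_mem_nhdsLT hR] with y hy using hstrip y hy t
  set τ : ι → Measure ℝ := fun i => (symmetrization (μ i)).tilted fun x => R * x with hτ
  have hprob : ∀ i, IsProbabilityMeasure (τ i) := fun i => isProbabilityMeasure_tilted (hmemR i)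
  have hnz : ∀ᶠ t : ℝ in nhds 0, ∀ i, charFun (τ i) t ≠ 0 := by
    rw [Filter.eventually_all]
    intro i
    refine (continuous_charFun (μ := τ i)).continuousAt.eventually_ne ?_
    simp
  have h0 := hbdry 0 fun i => by
    simpa [complexMGF_ofReal] using (hpos i).ne'
  simp only [Complex.ofReal_zero, zero_mul, add_zero, complexMGF_ofReal, Complex.norm_real] at h0
  obtain ⟨δ, hδ, h⟩ := exists_mem_integrableExpSet_symmetrization α hα (2 * c) τ (by
    filter_upwards [hnz.filter_mono nhdsWithin_le_nhds] with t ht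
    have hnum : ∀ i, complexMGF id (symmetrization (μ i)) (R + t * Complex.I) ≠ 0 := by
      intro i hi
      apply ht i
      simp only [hτ]
      rw [charFun_tilted_mul, hi, zero_div]
    have h1 := hbdry t hnum
    have h2 : ∀ i, Real.log ‖charFun (τ i) t‖
        = Real.log ‖complexMGF id (symmetrization (μ i)) (R + t * Complex.I)‖
          - Real.log ‖mgf id (symmetrization (μ i)) R‖ := by
      intro i
      simp only [hτ]
      rw [charFun_tilted_mul, norm_div, Complex.norm_real, Real.log_div
        (norm_ne_zero_iff.2 (hnum i)) (norm_ne_zero_iff.2 (hpos i).ne')]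
    simp_rw [h2, mul_sub]
    rw [Finset.sum_sub_distrib, h1, h0]
    ring)
  exact ⟨δ, hδ, fun i => add_mem_integrableExpSet_of_tilted (hmemR i)
    (mem_integrableExpSet_of_symmetrization (h i))⟩

theorem integrableExpSet_symmetrization_eq_univ {ι : Type*} [Fintype ι] (α : ι → ℝ)
    (hα : ∀ i, 0 < α i) (c : ℝ) (μ : ι → Measure ℝ) [∀ i, IsProbabilityMeasure (μ i)]
    (heq : ∀ᶠ t in nhdsWithin (0 : ℝ) (Set.Ioi 0),
      ∑ i, α i * Real.log ‖charFun (μ i) t‖ = -c * t ^ 2) (i : ι) :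
    integrableExpSet id (symmetrization (μ i)) = Set.univ := by
  set S : Set ℝ := {r | 0 ≤ r ∧ ∀ i, r ∈ integrableExpSet id (symmetrization (μ i))} with hS
  have hzero : ∀ i, (0 : ℝ) ∈ integrableExpSet id (symmetrization (μ i)) := fun i => by
    simp [integrableExpSet]
  have hdown : ∀ r ∈ S, ∀ s ∈ Set.Icc (-r) r, ∀ i,
      s ∈ integrableExpSet id (symmetrization (μ i)) := by
    intro r hr s hs i
    exact convex_integrableExpSet.ordConnected.out
      (neg_mem_integrableExpSet_symmetrization (hr.2 i)) (hr.2 i) hs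
  have hunb : ¬ BddAbove S := by
    intro hb
    obtain ⟨δ, hδ, h⟩ := exists_mem_integrableExpSet_symmetrization α hα c μ heq
    have hδS : δ ∈ S := ⟨hδ.le, h⟩
    have hR : 0 < sSup S := hδ.trans_le (le_csSup hb hδS)
    obtain ⟨η, hη, h'⟩ := exists_add_mem_integrableExpSet α hα c μ heq hR (fun r hr i => by
      have hlt : |r| < sSup S := abs_lt.2 hr
      obtain ⟨s, hs, hrs⟩ := exists_lt_of_lt_csSup ⟨δ, hδS⟩ hlt
      exact hdown s hs r (abs_le.1 hrs.le) i)
    have := le_csSup hb (show sSup S + η ∈ S from ⟨by linarith, h'⟩)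
    linarith
  refine Set.eq_univ_of_forall fun y => ?_
  obtain ⟨r, hr, hyr⟩ := not_bddAbove_iff.1 hunb |y|
  exact hdown r hr y (abs_le.1 hyr.le) i

theorem exists_exp_eq_of_entire {H : ℂ → ℂ} (hH : Differentiable ℂ H) (hne : ∀ z, H z ≠ 0)
    (h0 : H 0 = 1) :
    ∃ g : ℂ → ℂ, Differentiable ℂ g ∧ g 0 = 0 ∧ ∀ z, H z = Complex.exp (g z) := by
  have hd : Differentiable ℂ (deriv H) := hH.deriv
  obtain ⟨g, hg0, hg⟩ := ((hd.div hH hne).isExactOn_univ).with_val_at 0 0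
  have hg' : ∀ z, HasDerivAt g (deriv H z / H z) z := fun z => hg z (Set.mem_univ z)
  have hgd : Differentiable ℂ g := fun z => (hg' z).differentiableAt
  refine ⟨g, hgd, hg0, fun z => ?_⟩
  have hder : ∀ z, HasDerivAt (fun z => H z * Complex.exp (-g z)) 0 z := by
    intro z
    have h1 := (hH z).hasDerivAt.mul (hg' z).neg.cexp
    refine h1.congr_deriv ?_
    have := hne z
    field_simp
    ring
  have hconst := is_const_of_deriv_eq_zero (fun z => (hder z).differentiableAt)
    (fun z => (hder z).deriv) z 0
  simp only [h0, hg0, neg_zero, Complex.exp_zero, mul_one] at hconst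
  rw [Complex.exp_neg] at hconst
  exact eq_of_mul_inv_eq_one hconst

theorem exists_quadratic_of_re_le {g : ℂ → ℂ} (hg : Differentiable ℂ g) (h0 : g 0 = 0) {B : ℝ}
    (hB : 0 < B) (hle : ∀ z, (g z).re ≤ B * (1 + ‖z‖ ^ 2)) :
    ∃ a b : ℂ, ∀ z, g z = a * z + b * z ^ 2 := by
  have hbound : ∀ z, ‖g z‖ ≤ 2 * B * (1 + 4 * ‖z‖ ^ 2) := by
    intro z
    rcases eq_or_ne z 0 with rfl | hz
    · rw [h0, norm_zero]; positivity
    have hzp : 0 < ‖z‖ := norm_pos_iff.2 hz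
    have h := Complex.borelCaratheodory_zero (M := B * (1 + (2 * ‖z‖) ^ 2)) (R := 2 * ‖z‖) (z := z)
      (by positivity) hg.differentiableOn (fun w hw => by
        have hw : ‖w‖ < 2 * ‖z‖ := by simpa using hw
        refine (hle w).trans ?_
        gcongr) (by positivity) (by simp; linarith) h0
    refine h.trans (le_of_eq ?_)
    have : 2 * ‖z‖ - ‖z‖ = ‖z‖ := by ring
    rw [this]
    field_simp
    ring
  have hder : ∀ n, 3 ≤ n → iteratedDeriv n g 0 = 0 := by
    intro n hn
    have h1 : ∀ R : ℝ, 1 ≤ R → ‖iteratedDeriv n g 0‖ ≤ n.factorial * (10 * B) / R := by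
      intro R hR
      have hR0 : 0 < R := by linarith
      refine (Complex.norm_iteratedDeriv_le_of_forall_mem_sphere_norm_le n hR0 hg.diffContOnCl
        (C := 10 * B * R ^ 2) fun z hz => ?_).trans ?_
      · have hz : ‖z‖ = R := by simpa using hz
        refine (hbound z).trans ?_
        rw [hz]
        nlinarith [mul_le_mul_of_nonneg_left (one_le_pow₀ hR : 1 ≤ R ^ 2) hB.le]
      · rw [div_le_div_iff₀ (by positivity) hR0]
        have h3 : R ^ 3 ≤ R ^ n := pow_le_pow_right₀ hR hn
        calc (n.factorial : ℝ) * (10 * B * R ^ 2) * R = n.factorial * (10 * B) * R ^ 3 := by ring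
          _ ≤ _ := by gcongr
    have h2 : Filter.Tendsto (fun R : ℝ => n.factorial * (10 * B) / R) Filter.atTop (nhds 0) :=
      tendsto_const_nhds.div_atTop Filter.tendsto_id
    refine norm_le_zero_iff.1 (ge_of_tendsto h2 ?_)
    filter_upwards [Filter.eventually_ge_atTop 1] with R hR using h1 R hR
  refine ⟨iteratedDeriv 1 g 0, iteratedDeriv 2 g 0 / 2, fun z => ?_⟩
  rw [← Complex.taylorSeries_eq_of_entire' 0 z hg, tsum_eq_sum (s := Finset.range 3)]
  · simp only [Finset.sum_range_succ, Finset.sum_range_zero, iteratedDeriv_zero, h0, sub_zero,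
      Nat.factorial]
    push_cast
    ring
  · intro n hn
    rw [hder n (by simpa using hn)]
    simp

theorem exp_mul_integral_le_mgf {μ : Measure ℝ} [IsProbabilityMeasure μ] (hid : Integrable id μ)
    {y : ℝ} (hy : y ∈ integrableExpSet id μ) :
    Real.exp (y * ∫ x, x ∂μ) ≤ mgf id μ y := by
  set m : ℝ := ∫ x, x ∂μ with hm
  have hid : Integrable (fun x : ℝ => x) μ := hid
  have hsub : Integrable (fun x : ℝ => x - m) μ := hid.sub (integrable_const m)
  have h1 : ∫ x, Real.exp (y * m) * (y * (x - m) + 1) ∂μ ≤ mgf id μ y := by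
    refine integral_mono (((hsub.const_mul y).add (integrable_const 1)).const_mul _) hy fun x => ?_
    have := Real.add_one_le_exp (y * (x - m))
    calc Real.exp (y * m) * (y * (x - m) + 1) ≤ Real.exp (y * m) * Real.exp (y * (x - m)) := by
          gcongr
      _ = Real.exp (y * id x) := by rw [← Real.exp_add]; simp only [id_eq]; ring_nf
  refine le_trans (le_of_eq ?_) h1
  rw [integral_const_mul, integral_add (hsub.const_mul y) (integrable_const 1), integral_const_mul,
    integral_sub hid (integrable_const m)]
  simp [← hm]

theorem eq_gaussianReal_of_mgf_le {μ : Measure ℝ} [IsProbabilityMeasure μ]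
    (huniv : integrableExpSet id (symmetrization μ) = Set.univ)
    (hne : ∀ z, complexMGF id (symmetrization μ) z ≠ 0) {C : ℝ} (hC : 0 ≤ C)
    (hle : ∀ y, mgf id (symmetrization μ) y ≤ Real.exp (C * y ^ 2)) :
    ∃ a : ℝ, ∃ v : NNReal, μ = gaussianReal a v := by
  have hμ : integrableExpSet id μ = Set.univ :=
    Set.eq_univ_of_forall fun y =>
      mem_integrableExpSet_of_symmetrization (huniv ▸ Set.mem_univ y)
  have hmem : ∀ y, y ∈ integrableExpSet id μ := fun y => hμ ▸ Set.mem_univ y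
  have hid : Integrable id μ :=
    integrable_of_mem_interior_integrableExpSet (by rw [hμ, interior_univ]; trivial)
  have hH : Differentiable ℂ (complexMGF id μ) := by
    intro z
    refine (analyticAt_complexMGF ?_).differentiableAt
    rw [hμ, interior_univ]; trivial
  have hHne : ∀ z, complexMGF id μ z ≠ 0 := fun z hz => hne z (by
    rw [complexMGF_symmetrization, hz, zero_mul])
  obtain ⟨g, hg, hg0, hexp⟩ := exists_exp_eq_of_entire hH hHne (by simp [complexMGF])
  set m : ℝ := ∫ x, x ∂μ with hm
  have hmgf : ∀ y, mgf id μ y ≤ Real.exp (C * y ^ 2 + y * m) := by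
    intro y
    have h1 := exp_mul_integral_le_mgf hid (hmem (-y))
    have h2 := hle y
    rw [mgf_symmetrization] at h2
    have h3 : mgf id μ y * Real.exp (-y * m) ≤ Real.exp (C * y ^ 2) :=
      (mul_le_mul_of_nonneg_left h1 mgf_nonneg).trans h2
    rw [← le_div_iff₀ (Real.exp_pos _), ← Real.exp_sub] at h3
    refine h3.trans_eq ?_
    ring_nf
  have hre : ∀ z, (g z).re ≤ (C + |m| + 1) * (1 + ‖z‖ ^ 2) := by
    intro z
    have h1 : Real.exp (g z).re ≤ Real.exp (C * z.re ^ 2 + z.re * m) := by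
      rw [← Complex.norm_exp, ← hexp]
      exact norm_complexMGF_le_mgf.trans (hmgf _)
    have h2 := Real.exp_le_exp.1 h1
    have h3 := Complex.abs_re_le_norm z
    have h4 : z.re * m ≤ ‖z‖ * |m| := (le_abs_self _).trans (by rw [abs_mul]; gcongr)
    have h5 : z.re ^ 2 ≤ ‖z‖ ^ 2 := by rw [← sq_abs]; gcongr
    have h6 : ‖z‖ ≤ 1 + ‖z‖ ^ 2 := by nlinarith [sq_nonneg (‖z‖ - 1), norm_nonneg z]
    have h7 := mul_le_mul_of_nonneg_left h5 hC
    have h8 := mul_le_mul_of_nonneg_right h6 (abs_nonneg m)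
    nlinarith [sq_nonneg ‖z‖]
  obtain ⟨a, b, hab⟩ := exists_quadratic_of_re_le hg hg0 (by positivity) hre
  have hreal : ∀ y : ℝ, mgf id μ y = Real.exp (a.re * y + b.re * y ^ 2) := by
    intro y
    have h1 := congrArg norm (hexp y)
    rw [complexMGF_ofReal, Complex.norm_real, Real.norm_of_nonneg mgf_nonneg, Complex.norm_exp,
      hab] at h1
    rw [h1]
    congr 1
    rw [← Complex.ofReal_pow, Complex.add_re, Complex.re_mul_ofReal, Complex.re_mul_ofReal]
  have hb : 0 ≤ b.re := by
    have h1 := one_le_mgf_symmetrization (huniv ▸ Set.mem_univ (1 : ℝ))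
    rw [mgf_symmetrization, hreal, hreal, ← Real.exp_add, Real.one_le_exp_iff] at h1
    linarith
  obtain ⟨v, hv⟩ : ∃ v : NNReal, (v : ℝ) = 2 * b.re := ⟨⟨2 * b.re, by positivity⟩, rfl⟩
  refine ⟨a.re, v, ?_⟩
  refine Measure.ext_of_complexMGF_id_eq (funext fun z => ?_)
  refine eqOn_complexMGF_of_mgf (funext fun y => ?_) ?_
  · rw [hreal, mgf_gaussianReal (μ := a.re) (v := v) (by simp), hv]
    congr 1
    ring
  · rw [hμ, interior_univ]; trivial

theorem exists_eq_gaussianReal_of_sum_log_norm_charFun {m : ℕ} (μ : Fin m → Measure ℝ)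
    (hμ : ∀ i, IsProbabilityMeasure (μ i)) (α : Fin m → ℝ) (hα : ∀ i, 0 < α i) (c : ℝ)
    (heq : ∀ᶠ t in nhdsWithin (0 : ℝ) (Set.Ioi 0),
      ∑ i, α i * Real.log ‖charFun (μ i) t‖ = -c * t ^ 2) :
    ∀ i, ∃ a : ℝ, ∃ v : NNReal, μ i = gaussianReal a v := by
  intro i
  have huniv := fun j => integrableExpSet_symmetrization_eq_univ α hα c μ heq j
  have hmem : ∀ j y, y ∈ integrableExpSet id (symmetrization (μ j)) := fun j y =>
    huniv j ▸ Set.mem_univ y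
  have hz : ∀ z : ℂ, _ := fun z => complexMGF_ne_zero_and_sum_log_norm_eq α hα c μ heq
    (R := |z.re| + 1) (by positivity) (fun r _ j => hmem j r) (z := z)
    (abs_lt.1 (lt_add_one |z.re|))
  refine eq_gaussianReal_of_mgf_le (C := |2 * c| / α i) (huniv i) (fun z => (hz z).1 i)
    (div_nonneg (abs_nonneg _) (hα i).le) fun y => ?_
  have hone : ∀ j, 1 ≤ mgf id (symmetrization (μ j)) y := fun j =>
    one_le_mgf_symmetrization (hmem j y)
  have h1 := (hz y).2
  have h2 : ∀ j, ‖complexMGF id (symmetrization (μ j)) y‖ = mgf id (symmetrization (μ j)) y :=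
    fun j => by rw [complexMGF_ofReal, Complex.norm_real, Real.norm_of_nonneg mgf_nonneg]
  simp_rw [h2] at h1
  rw [← Complex.ofReal_pow, ← Complex.ofReal_mul, Complex.ofReal_re] at h1
  have h3 := Finset.single_le_sum (f := fun j => α j * Real.log (mgf id (symmetrization (μ j)) y))
    (fun j _ => mul_nonneg (hα j).le (Real.log_nonneg (hone j))) (Finset.mem_univ i)
  have h4 : 2 * c * y ^ 2 ≤ |2 * c| * y ^ 2 :=
    mul_le_mul_of_nonneg_right (le_abs_self _) (sq_nonneg y)
  rw [← Real.exp_log (show 0 < mgf id (symmetrization (μ i)) y by linarith [hone i]),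
    Real.exp_le_exp, div_mul_eq_mul_div, le_div_iff₀ (hα i)]
  linarith

theorem charFunM_eq_charFun (μ : Measure ℝ) (t : ℝ) : charFunM μ t = charFun μ t := by
  rw [charFun_apply_real, charFunM]
  simp_rw [mul_comm Complex.I]

/-- **Zinger–Linnik generalization of Cramér's theorem.** If the product
`∏ fᵢ(t)^{αᵢ}` of (fractional, via the continuous branch of the logarithm with
`log fᵢ(0) = 0`) powers of characteristic functions equals `exp (c t²)` with `c < 0` on a
neighborhood of `0` where all the `fᵢ` are nonvanishing, then every `μᵢ` is a (possibly
degenerate) Gaussian distribution. -/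
theorem zinger_linnik (m : ℕ) (μ : Fin m → Measure ℝ) (hμ : ∀ i, IsProbabilityMeasure (μ i))
    (α : Fin m → ℝ) (hα : ∀ i, 0 < α i) (c ε : ℝ) (hc : c < 0) (hε : 0 < ε)
    (hnv : ∀ i, ∀ t ∈ Ioo (-ε) ε, charFunM (μ i) t ≠ 0)
    (L : Fin m → ℝ → ℂ)
    (hLcont : ∀ i, ContinuousOn (L i) (Ioo (-ε) ε))
    (hL0 : ∀ i, L i 0 = 0)
    (hLlog : ∀ i, ∀ t ∈ Ioo (-ε) ε, Complex.exp (L i t) = charFunM (μ i) t)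
    (heq : ∀ t ∈ Ioo (-ε) ε,
      ∏ i, Complex.exp ((α i : ℂ) * L i t) = Complex.exp ((c : ℂ) * (t : ℂ) ^ 2)) :
    ∀ i, ∃ a : ℝ, ∃ v : NNReal, μ i = gaussianReal a v := by
  refine exists_eq_gaussianReal_of_sum_log_norm_charFun μ hμ α hα (-c) ?_
  filter_upwards [Ioo_mem_nhdsGT hε] with t ht
  have ht : t ∈ Ioo (-ε) ε := ⟨by linarith [ht.1], ht.2⟩
  have hre : ∀ i, Real.log ‖charFun (μ i) t‖ = (L i t).re := fun i => by
    rw [← charFunM_eq_charFun, ← hLlog i t ht, Complex.norm_exp, Real.log_exp]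
  have h := congrArg norm (heq t ht)
  rw [← Complex.exp_sum, Complex.norm_exp, Complex.norm_exp, Real.exp_eq_exp, Complex.re_sum,
    ← Complex.ofReal_pow, ← Complex.ofReal_mul, Complex.ofReal_re] at h
  simp_rw [hre, neg_neg, ← h, Complex.re_ofReal_mul]
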